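/- Assume d ≥ 3, Ω is irreducible, and the torsion-free group Γ divides Ω. Then Ω is not completely foliated by flats: there exists a point of Ω that is not contained in any flat of Ω. -/

import Mathlib

open Set Filter Metric

noncomputable section

/-- `ℝ^d`. -/
abbrev Euc (d : ℕ) := EuclideanSpace ℝ (Fin d)

/-- A flat of `Ω` with prescribed vertices `v`. -/
def IsFlatWith {d : ℕ} (Ω : Set (Euc d)) (v : Fin d → Euc d) : Prop :=
  AffineIndependent ℝ v ∧
  (∀ j, v j ∈ closure Ω \ Ω) ∧
  intrinsicInterior ℝ (convexHull ℝ (Set.range v)) ⊆ Ω ∧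
  convexHull ℝ (Set.range v) \ intrinsicInterior ℝ (convexHull ℝ (Set.range v)) ⊆ closure Ω \ Ω

/-- A (codimension-one, properly embedded) flat of `Ω`. -/
def IsFlat {d : ℕ} (Ω : Set (Euc d)) (F : Set (Euc d)) : Prop :=
  ∃ v : Fin d → Euc d, IsFlatWith Ω v ∧ F = intrinsicInterior ℝ (convexHull ℝ (Set.range v))

/-- The cone over a subset of `ℝ^d`, inside `ℝ^d × ℝ ≅ ℝ^{d+1}`. -/
def coneOver {d : ℕ} (S : Set (Euc d)) : Set (Euc d × ℝ) :=
  {p | ∃ t : ℝ, 0 < t ∧ ∃ x ∈ S, p = t • (x, (1 : ℝ))}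

/-- Irreducibility of a properly convex domain: its cone admits no direct-sum
decomposition into convex cones. -/
def IsIrreducibleDomain {d : ℕ} (Ω : Set (Euc d)) : Prop :=
  ¬ ∃ (V₁ V₂ : Submodule ℝ (Euc d × ℝ)) (C₁ C₂ : Set (Euc d × ℝ)),
      V₁ ≠ ⊥ ∧ V₂ ≠ ⊥ ∧ V₁ ≠ ⊤ ∧ V₂ ≠ ⊤ ∧ IsCompl V₁ V₂ ∧
      C₁ ⊆ (V₁ : Set (Euc d × ℝ)) ∧ C₂ ⊆ (V₂ : Set (Euc d × ℝ)) ∧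
      Convex ℝ C₁ ∧ Convex ℝ C₂ ∧
      (∀ t : ℝ, 0 < t → ∀ c ∈ C₁, t • c ∈ C₁) ∧
      (∀ t : ℝ, 0 < t → ∀ c ∈ C₂, t • c ∈ C₂) ∧
      coneOver Ω = {p | ∃ c₁ ∈ C₁, ∃ c₂ ∈ C₂, p = c₁ + c₂}

/-- The homeomorphism of `Ω` induced by a linear automorphism of `ℝ^{d+1}`
preserving the cone over `Ω`. -/
def projAct {d : ℕ} (g : (Euc d × ℝ) ≃ₗ[ℝ] (Euc d × ℝ)) (x : Euc d) : Euc d :=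
  ((g (x, 1)).2)⁻¹ • (g (x, 1)).1

/-- `Γ` divides `Ω`: every element preserves the cone over `Ω`; the induced action on `Ω`
is free and properly discontinuous, and admits a compact set whose translates cover `Ω`. -/
def Divides {d : ℕ} (Ω : Set (Euc d))
    (Γ : Subgroup ((Euc d × ℝ) ≃ₗ[ℝ] (Euc d × ℝ))) : Prop :=
  (∀ γ ∈ Γ, (γ : (Euc d × ℝ) ≃ₗ[ℝ] (Euc d × ℝ)) '' coneOver Ω = coneOver Ω) ∧
  (∀ γ ∈ Γ, γ ≠ 1 → ∀ x ∈ Ω, projAct γ x ≠ x) ∧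
  (∀ K : Set (Euc d), K ⊆ Ω → IsCompact K →
    {γ : (Euc d × ℝ) ≃ₗ[ℝ] (Euc d × ℝ) | γ ∈ Γ ∧ (projAct γ '' K ∩ K).Nonempty}.Finite) ∧
  (∃ K : Set (Euc d), K ⊆ Ω ∧ IsCompact K ∧ (⋃ γ ∈ Γ, projAct γ '' K) = Ω)

/-- `Γ` is torsion-free. -/
def TorsionFreeSub {d : ℕ} (Γ : Subgroup ((Euc d × ℝ) ≃ₗ[ℝ] (Euc d × ℝ))) : Prop :=
  ∀ γ ∈ Γ, ∀ n : ℕ, n ≠ 0 → γ ^ n = 1 → γ = 1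

/-- Convergence of a sequence of flats: Hausdorff convergence of their closures. -/
def FlatsConverge {d : ℕ} (Fs : ℕ → Set (Euc d)) (F : Set (Euc d)) : Prop :=
  Tendsto (fun i => hausdorffDist (closure (Fs i)) (closure F)) atTop (nhds 0)

/-- A flat is isolated if no sequence of flats, all distinct from it, converges to it. -/
def IsIsolatedFlat {d : ℕ} (Ω F : Set (Euc d)) : Prop :=
  ¬ ∃ Fs : ℕ → Set (Euc d), (∀ i, IsFlat Ω (Fs i)) ∧ (∀ i, Fs i ≠ F) ∧ FlatsConverge Fs F

/-- The union of all flats of `Ω`. -/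
def flatsUnion {d : ℕ} (Ω : Set (Euc d)) : Set (Euc d) := ⋃₀ {F | IsFlat Ω F}

/-- A boundary flat: a flat contained in the closure of a connected component of the
complement of the union of all flats. -/
def IsBoundaryFlat {d : ℕ} (Ω F : Set (Euc d)) : Prop :=
  IsFlat Ω F ∧ ∃ x ∈ Ω \ flatsUnion Ω,
    F ⊆ closure (connectedComponentIn (Ω \ flatsUnion Ω) x)

/-- Nonempty open convex cones, not required to be salient. -/
structure IsOpenCone {V : Type*} [NormedAddCommGroup V] [NormedSpace ℝ V] (C : Set V) : Prop where
  nonempty : C.Nonempty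
  isOpen : IsOpen C
  convex : Convex ℝ C
  smul_mem : ∀ t : ℝ, 0 < t → ∀ x ∈ C, t • x ∈ C

namespace IsOpenCone

variable {V : Type*} [NormedAddCommGroup V] [NormedSpace ℝ V] {C : Set V}

theorem add_mem (hC : IsOpenCone C) {x y : V} (hx : x ∈ C) (hy : y ∈ C) : x + y ∈ C := by
  have h := hC.smul_mem 2 two_pos _
    (hC.convex hx hy (a := 1 / 2) (b := 1 / 2) (by norm_num) (by norm_num) (by norm_num))
  have e : (2 : ℝ) • ((1 / 2 : ℝ) • x + (1 / 2 : ℝ) • y) = x + y := by module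
  rwa [e] at h

theorem add_closure_mem (hC : IsOpenCone C) {x y : V} (hx : x ∈ C) (hy : y ∈ closure C) :
    x + y ∈ C := by
  have ho : IsOpen {z | x + y - z ∈ C} := hC.isOpen.preimage (by fun_prop)
  obtain ⟨z, hz, hzC⟩ := mem_closure_iff.1 hy _ ho (by simpa using hx)
  simpa using hC.add_mem hz hzC

theorem smul_mem_closure_of_pos (hC : IsOpenCone C) {t : ℝ} (ht : 0 < t) {x : V}
    (hx : x ∈ closure C) : t • x ∈ closure C :=
  map_mem_closure (by fun_prop : Continuous fun x : V => t • x) hx fun y hy => hC.smul_mem t ht y hy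

theorem zero_mem_closure (hC : IsOpenCone C) : (0 : V) ∈ closure C := by
  obtain ⟨x, hx⟩ := hC.nonempty
  have h : Tendsto (fun t : ℝ => t • x) (nhdsWithin 0 (Ioi 0)) (nhds 0) := by
    have : Continuous fun t : ℝ => t • x := by fun_prop
    simpa using (this.tendsto 0).mono_left nhdsWithin_le_nhds
  exact mem_closure_of_tendsto h
    (eventually_mem_nhdsWithin.mono fun t ht => hC.smul_mem t ht x hx)

theorem smul_mem_closure (hC : IsOpenCone C) {t : ℝ} (ht : 0 ≤ t) {x : V}
    (hx : x ∈ closure C) : t • x ∈ closure C := by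
  rcases ht.eq_or_lt with rfl | ht
  · simpa using hC.zero_mem_closure
  · exact hC.smul_mem_closure_of_pos ht hx

theorem add_mem_closure (hC : IsOpenCone C) {x y : V} (hx : x ∈ closure C) (hy : y ∈ closure C) :
    x + y ∈ closure C :=
  map_mem_closure₂ (by fun_prop : Continuous fun p : V × V => p.1 + p.2) hx hy
    fun _ ha _ hb => hC.add_mem ha hb

theorem sum_mem_closure (hC : IsOpenCone C) {ι : Type*} (s : Finset ι) {v : ι → V} {a : ι → ℝ}
    (ha : ∀ i ∈ s, 0 ≤ a i) (hv : ∀ i ∈ s, v i ∈ closure C) : ∑ i ∈ s, a i • v i ∈ closure C :=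
  Finset.sum_induction _ (· ∈ closure C) (fun _ _ => hC.add_mem_closure) hC.zero_mem_closure
    fun i hi => hC.smul_mem_closure (ha i hi) (hv i hi)

theorem sum_smul_mem_of_pos (hC : IsOpenCone C) {ι : Type*} [Fintype ι] {v : ι → V} {a : ι → ℝ}
    (hs : ∑ i, v i ∈ C) (hv : ∀ i, v i ∈ closure C) (ha : ∀ i, 0 < a i) :
    ∑ i, a i • v i ∈ C := by
  obtain ⟨ε, hε, h⟩ : ∃ ε : ℝ, 0 < ε ∧ ∀ i, ε ≤ a i := by
    rcases isEmpty_or_nonempty ι with h | h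
    · exact ⟨1, one_pos, fun i => h.elim i⟩
    · obtain ⟨j, hj⟩ := Finite.exists_min a
      exact ⟨a j, ha j, hj⟩
  have e : ∑ i, a i • v i = ε • ∑ i, v i + ∑ i, (a i - ε) • v i := by
    rw [Finset.smul_sum, ← Finset.sum_add_distrib]
    exact Finset.sum_congr rfl fun i _ => by module
  rw [e]
  exact hC.add_closure_mem (hC.smul_mem ε hε _ hs)
    (hC.sum_mem_closure _ (fun i _ => sub_nonneg.2 (h i)) fun i _ => hv i)

theorem subset_of_subset_closure (hC : IsOpenCone C) {A : Set V} (hA : IsOpen A)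
    (h : A ⊆ closure C) : A ⊆ C := by
  have := interior_maximal h hA
  rwa [hC.convex.interior_closure_eq_interior_of_nonempty_interior
    (by simpa [hC.isOpen.interior_eq] using hC.nonempty), hC.isOpen.interior_eq] at this

theorem nonneg_of_mem_closure {f : V →L[ℝ] ℝ} (hf : ∀ x ∈ C, 0 ≤ f x) {x : V}
    (hx : x ∈ closure C) : 0 ≤ f x :=
  closure_minimal (show C ⊆ {x | 0 ≤ f x} from hf)
    (isClosed_le continuous_const f.continuous) hx

theorem exists_support (hC : IsOpenCone C) {x : V} (hx : x ∈ closure C) (hx' : x ∉ C) :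
    ∃ g : V →L[ℝ] ℝ, (∀ y ∈ C, 0 < g y) ∧ g x = 0 := by
  obtain ⟨f, hf⟩ := geometric_hahn_banach_open_point hC.convex hC.isOpen hx'
  have hx0 : 0 ≤ f x := by
    have h : closure C ⊆ {y | f y ≤ f x} :=
      closure_minimal (fun y hy => (hf y hy).le) (isClosed_le f.continuous continuous_const)
    simpa using h hC.zero_mem_closure
  have hle : ∀ y ∈ C, f y ≤ 0 := by
    intro y hy
    by_contra! h
    have := hf _ (hC.smul_mem ((f x + 1) / f y) (by positivity) y hy)
    rw [map_smul, smul_eq_mul, div_mul_cancel₀ _ h.ne'] at this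
    linarith
  have hx1 : f x = 0 := by
    refine le_antisymm ?_ hx0
    have := nonneg_of_mem_closure (f := -f) (fun y hy => by simpa using hle y hy) hx
    simpa using this
  exact ⟨-f, fun y hy => by simpa [hx1] using hf y hy, by simpa using hx1⟩

end IsOpenCone

/-- Salient open convex cones on which the linear automorphisms act cocompactly and which do not
split off a one-dimensional factor. -/
structure IsDivisibleCone {V : Type*} [NormedAddCommGroup V] [NormedSpace ℝ V] (C : Set V) : Prop
    extends IsOpenCone C where
  salient : ∃ l : V →L[ℝ] ℝ, ∀ x ∈ C, ‖x‖ ≤ l x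
  cocompact : ∃ K ⊆ C, IsCompact K ∧ ∀ x ∈ C, ∃ g : V ≃L[ℝ] V, (∀ y, g y ∈ C ↔ y ∈ C) ∧ g x ∈ K
  irreducible : ∀ (φ : V →L[ℝ] ℝ) (o : V), φ o = 1 → (∀ y ∈ C, 0 < φ y) →
    ∃ y ∈ C, ∃ s : ℝ, 0 < φ (y + s • o) ∧ y + s • o ∉ C

theorem ContinuousLinearMap.opNorm_le_of_bound_on_ball {V W : Type*} [NormedAddCommGroup V]
    [NormedSpace ℝ V] [NormedAddCommGroup W] [NormedSpace ℝ W] (f : V →L[ℝ] W) {r B : ℝ}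
    (hr : 0 < r) (hB : 0 ≤ B) (h : ∀ x, ‖x‖ < r → ‖f x‖ ≤ B) : ‖f‖ ≤ 2 * B / r := by
  refine f.opNorm_le_bound (by positivity) fun x => ?_
  rcases eq_or_ne x 0 with rfl | hx
  · simp
  have hx' : 0 < ‖x‖ := norm_pos_iff.2 hx
  have := h ((r / 2 / ‖x‖) • x) (by
    rw [norm_smul, Real.norm_of_nonneg (by positivity), div_mul_cancel₀ _ hx'.ne']; linarith)
  rw [map_smul, norm_smul, Real.norm_of_nonneg (by positivity)] at this
  calc ‖f x‖ = (r / 2 / ‖x‖ * ‖f x‖) * (2 * ‖x‖ / r) := by field_simp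
    _ ≤ B * (2 * ‖x‖ / r) := by gcongr
    _ = 2 * B / r * ‖x‖ := by ring

theorem tendsto_clm_apply {V W α : Type*} [NormedAddCommGroup V] [NormedSpace ℝ V]
    [NormedAddCommGroup W] [NormedSpace ℝ W] {F : Filter α} {b : α → V →L[ℝ] W} {β : V →L[ℝ] W}
    {y : α → V} {y₀ : V} (hb : Tendsto b F (nhds β)) (hy : Tendsto y F (nhds y₀)) :
    Tendsto (fun n => b n (y n)) F (nhds (β y₀)) :=
  ((isBoundedBilinearMap_apply (𝕜 := ℝ) (E := V) (F := W)).continuous.tendsto (β, y₀)).comp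
    (hb.prodMk_nhds hy)

theorem exists_norm_le_of_salient {V : Type*} [NormedAddCommGroup V] [NormedSpace ℝ V]
    [FiniteDimensional ℝ V] {P : Set V} (hcl : IsClosed P)
    (hsmul : ∀ t : ℝ, 0 < t → ∀ x ∈ P, t • x ∈ P) (hsal : ∀ x, x ∈ P → -x ∈ P → x = 0) :
    ∃ κ : ℝ, 0 ≤ κ ∧ ∀ x w, x + w ∈ P → x - w ∈ P → ‖w‖ ≤ κ * ‖x‖ := by
  let S : Set (V × V) := (closedBall 0 1 ×ˢ sphere 0 1) ∩ {p | p.1 + p.2 ∈ P ∧ p.1 - p.2 ∈ P}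
  have hS : IsCompact S := by
    refine ((isCompact_closedBall 0 1).prod (isCompact_sphere 0 1)).inter_right ?_
    exact (hcl.preimage (by fun_prop : Continuous fun p : V × V => p.1 + p.2)).inter
      (hcl.preimage (by fun_prop : Continuous fun p : V × V => p.1 - p.2))
  obtain ⟨ε, hε, hεS⟩ : ∃ ε : ℝ, 0 < ε ∧ ∀ p ∈ S, ε ≤ ‖p.1‖ := by
    rcases S.eq_empty_or_nonempty with h | h
    · exact ⟨1, one_pos, by simp [h]⟩
    · obtain ⟨p, hp, hmin⟩ := hS.exists_isMinOn h
        (by fun_prop : ContinuousOn (fun p : V × V => ‖p.1‖) S)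
      refine ⟨‖p.1‖, norm_pos_iff.2 fun h0 => ?_, fun q hq => hmin hq⟩
      obtain ⟨⟨-, h1⟩, h2, h3⟩ := hp
      rw [h0, zero_add] at h2
      rw [h0, zero_sub] at h3
      have := hsal _ h2 h3
      simp [this] at h1
  refine ⟨1 + ε⁻¹, by positivity, fun x w h1 h2 => ?_⟩
  rcases eq_or_ne w 0 with rfl | hw
  · simp; positivity
  have hw' : 0 < ‖w‖ := norm_pos_iff.2 hw
  rcases le_total ‖w‖ ‖x‖ with hle | hle
  · have : 0 ≤ ε⁻¹ * ‖x‖ := by positivity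
    linarith
  · have hmem : (‖w‖⁻¹ • x, ‖w‖⁻¹ • w) ∈ S := by
      refine ⟨⟨?_, ?_⟩, ?_, ?_⟩
      · rw [mem_closedBall_zero_iff, norm_smul, norm_inv, norm_norm, inv_mul_le_one₀ hw']
        exact hle
      · rw [mem_sphere_zero_iff_norm, norm_smul, norm_inv, norm_norm, inv_mul_cancel₀ hw'.ne']
      · simpa [smul_add] using hsmul _ (inv_pos.2 hw') _ h1
      · simpa [smul_sub] using hsmul _ (inv_pos.2 hw') _ h2
    have := hεS _ hmem
    rw [norm_smul, norm_inv, norm_norm, inv_mul_eq_div, le_div_iff₀ hw'] at this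
    have h3 : ‖w‖ ≤ ε⁻¹ * ‖x‖ := by
      rw [inv_mul_eq_div, le_div_iff₀ hε]; linarith
    linarith [norm_nonneg x]

namespace IsDivisibleCone

variable {V : Type*} [NormedAddCommGroup V] [NormedSpace ℝ V] {C : Set V}

theorem preimage (hC : IsDivisibleCone C) (b : V ≃L[ℝ] V) : IsDivisibleCone (b ⁻¹' C) where
  nonempty := hC.nonempty.preimage b.surjective
  isOpen := hC.isOpen.preimage b.continuous
  convex := hC.convex.linear_preimage (b : V →ₗ[ℝ] V)
  smul_mem t ht x hx := by simpa using hC.smul_mem t ht _ hx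
  salient := by
    obtain ⟨l, hl⟩ := hC.salient
    refine ⟨‖(b.symm : V →L[ℝ] V)‖ • l.comp (b : V →L[ℝ] V), fun x hx => ?_⟩
    calc ‖x‖ = ‖(b.symm : V →L[ℝ] V) (b x)‖ := by simp
      _ ≤ ‖(b.symm : V →L[ℝ] V)‖ * ‖b x‖ := ContinuousLinearMap.le_opNorm _ _
      _ ≤ ‖(b.symm : V →L[ℝ] V)‖ * l (b x) := by gcongr; exact hl _ hx
  cocompact := by
    obtain ⟨K, hKC, hK, h⟩ := hC.cocompact
    refine ⟨b ⁻¹' K, preimage_mono hKC, b.toHomeomorph.isCompact_preimage.2 hK, fun x hx => ?_⟩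
    obtain ⟨g, hg, hgx⟩ := h _ hx
    exact ⟨(b.trans g).trans b.symm, fun y => by simp [hg], by simpa using hgx⟩
  irreducible φ o ho hφ := by
    obtain ⟨y, hy, s, h1, h2⟩ := hC.irreducible (φ.comp (b.symm : V →L[ℝ] V)) (b o) (by simpa)
      (fun y hy => hφ _ (by simpa))
    refine ⟨b.symm y, by simpa, s, by simpa using h1, by simpa using h2⟩

/-- Compactness of the space of renormalisations of a divisible cone. -/
theorem exists_limit [FiniteDimensional ℝ V] (hC : IsDivisibleCone C) {α : Type*}
    (F : Ultrafilter α) (a : α → V ≃L[ℝ] V) {x : α → V} {R r : ℝ} (hr : 0 < r)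
    (hx : ∀ n, ‖x n‖ ≤ R) (hball : ∀ n y, ‖y - x n‖ < r → a n y ∈ C) {P : Set V}
    (hcl : IsClosed P) (hsmul : ∀ t : ℝ, 0 < t → ∀ x ∈ P, t • x ∈ P)
    (hsal : ∀ x, x ∈ P → -x ∈ P → x = 0) (hP : ∀ n y, a n y ∈ C → y ∈ P) :
    ∃ C' : Set V, IsDivisibleCone C' ∧
      (∀ (y : α → V) (y₀ : V), Tendsto y F (nhds y₀) → (∀ᶠ n in F, a n (y n) ∈ closure C) →
        y₀ ∈ closure C') ∧
      ∀ (y : α → V) (y₀ : V), Tendsto y F (nhds y₀) → y₀ ∈ C' → ∀ᶠ n in F, a n (y n) ∈ C := by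
  obtain ⟨K, hKC, hK, hcoc⟩ := hC.cocompact
  have hxC : ∀ n, a n (x n) ∈ C := fun n => hball n _ (by simpa using hr)
  choose γ hγ hγK using fun n => hcoc _ (hxC n)
  let b : α → V ≃L[ℝ] V := fun n => (a n).trans (γ n)
  have hb : ∀ n y, b n y ∈ C ↔ a n y ∈ C := fun n y => hγ n _
  have hbK : ∀ n, b n (x n) ∈ K := hγK
  obtain ⟨l, hl⟩ := hC.salient
  obtain ⟨B, hB⟩ := hK.exists_bound_of_continuousOn l.continuous.continuousOn
  obtain ⟨δ, hδ, hδC⟩ := hK.exists_thickening_subset_open hC.isOpen hKC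
  obtain ⟨κ, hκ, hκP⟩ := exists_norm_le_of_salient hcl hsmul hsal
  have hb1 : ∀ n, ‖(b n : V →L[ℝ] V)‖ ≤ 2 * |B| / r := fun n => by
    refine ContinuousLinearMap.opNorm_le_of_bound_on_ball _ hr (abs_nonneg _) fun w hw => ?_
    have h1 : b n (x n + w) ∈ C := (hb _ _).2 (hball _ _ (by simpa using hw))
    have h2 : b n (x n - w) ∈ C := (hb _ _).2 (hball _ _ (by simpa using hw))
    have h3 := hl _ h1
    have h4 := hl _ h2
    have h5 := (le_abs_self _).trans (hB _ (hbK n))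
    have h6 := norm_sub_le (b n (x n + w)) (b n (x n - w))
    have h7 : b n (x n + w) - b n (x n - w) = (2 : ℝ) • b n w := by
      rw [map_add, map_sub]; module
    rw [h7, norm_smul, Real.norm_of_nonneg zero_le_two] at h6
    rw [map_add, map_add] at h3
    rw [map_sub, map_sub] at h4
    rw [map_add, map_sub] at h6
    have h8 := le_abs_self B
    simp only [ContinuousLinearEquiv.coe_coe] at *
    linarith
  have hb2 : ∀ n, ‖((b n).symm : V →L[ℝ] V)‖ ≤ 2 * (κ * |R|) / δ := fun n => by
    refine ContinuousLinearMap.opNorm_le_of_bound_on_ball _ hδ (by positivity) fun u hu => ?_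
    have key : ∀ u : V, ‖u‖ < δ → x n + (b n).symm u ∈ P := fun u hu => by
      refine hP n _ ((hb _ _).1 (hδC (mem_thickening_iff.2 ⟨b n (x n), hbK n, ?_⟩)))
      simpa [dist_eq_norm] using hu
    have h2 := key (-u) (by simpa using hu)
    rw [map_neg, ← sub_eq_add_neg] at h2
    refine (hκP _ _ (key u hu) h2).trans ?_
    gcongr
    exact (hx n).trans (le_abs_self R)
  have : ProperSpace (V →L[ℝ] V) := FiniteDimensional.proper_real _
  obtain ⟨β, -, hβ⟩ := (isCompact_closedBall (0 : V →L[ℝ] V) (2 * |B| / r)).ultrafilter_le_nhds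
    (F.map fun n => (b n : V →L[ℝ] V)) (by
      simp only [Ultrafilter.coe_map, le_principal_iff, mem_map]
      exact univ_mem' fun n => by simpa using hb1 n)
  obtain ⟨β', -, hβ'⟩ := (isCompact_closedBall (0 : V →L[ℝ] V)
    (2 * (κ * |R|) / δ)).ultrafilter_le_nhds
    (F.map fun n => ((b n).symm : V →L[ℝ] V)) (by
      simp only [Ultrafilter.coe_map, le_principal_iff, mem_map]
      exact univ_mem' fun n => by simpa using hb2 n)
  replace hβ : Tendsto (fun n => (b n : V →L[ℝ] V)) F (nhds β) := hβ
  replace hβ' : Tendsto (fun n => ((b n).symm : V →L[ℝ] V)) F (nhds β') := hβ'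
  have h1 : ∀ x, β' (β x) = x := fun x => by
    refine tendsto_nhds_unique (tendsto_clm_apply hβ' (tendsto_clm_apply hβ tendsto_const_nhds)) ?_
    simp
  have h2 : ∀ x, β (β' x) = x := fun x => by
    refine tendsto_nhds_unique (tendsto_clm_apply hβ (tendsto_clm_apply hβ' tendsto_const_nhds)) ?_
    simp
  let e : V ≃L[ℝ] V := ContinuousLinearEquiv.equivOfInverse β β' h1 h2
  refine ⟨e ⁻¹' C, hC.preimage e, fun y y₀ hy h => ?_, fun y y₀ hy h => ?_⟩
  · rw [← e.preimage_closure]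
    refine isClosed_closure.mem_of_tendsto (tendsto_clm_apply hβ hy) (h.mono fun n hn => ?_)
    have hpre : b n ⁻¹' C = a n ⁻¹' C := ext fun y => hb n y
    have h3 : y n ∈ closure (b n ⁻¹' C) := by
      rw [hpre, ← (a n).preimage_closure]; exact hn
    rw [← (b n).preimage_closure] at h3
    exact h3
  · exact ((tendsto_clm_apply hβ hy).eventually (hC.isOpen.mem_nhds h)).mono fun n hn => (hb _ _).1 hn

end IsDivisibleCone

/-- The linear map scaling the direction `o` by `c` and fixing the kernel of `φ`. -/
def stretch {V : Type*} [NormedAddCommGroup V] [NormedSpace ℝ V] (φ : V →L[ℝ] ℝ) (o : V)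
    (ho : φ o = 1) (c : ℝ) (hc : c ≠ 0) : V ≃L[ℝ] V :=
  ContinuousLinearEquiv.equivOfInverse
    (ContinuousLinearMap.id ℝ V + (c - 1) • φ.smulRight o)
    (ContinuousLinearMap.id ℝ V + (c⁻¹ - 1) • φ.smulRight o)
    (fun y => by
      simp only [add_apply, ContinuousLinearMap.id_apply, smul_apply,
        ContinuousLinearMap.smulRight_apply, map_add, map_smul, ho]
      match_scalars <;> field_simp
      ring)
    (fun y => by
      simp only [add_apply, ContinuousLinearMap.id_apply, smul_apply,
        ContinuousLinearMap.smulRight_apply, map_add, map_smul, ho]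
      match_scalars <;> field_simp
      ring)

theorem stretch_apply {V : Type*} [NormedAddCommGroup V] [NormedSpace ℝ V] (φ : V →L[ℝ] ℝ) (o : V)
    (ho : φ o = 1) (c : ℝ) (hc : c ≠ 0) (y : V) :
    stretch φ o ho c hc y = y + ((c - 1) * φ y) • o := by
  simp [stretch, smul_smul]

namespace IsDivisibleCone

variable {V : Type*} [NormedAddCommGroup V] [NormedSpace ℝ V] {C : Set V}

/-- The tangent cone at a boundary ray of a divisible cone contains a further line. -/
theorem exists_line [FiniteDimensional ℝ V] (hC : IsDivisibleCone C) {v : V} (hv : v ∈ closure C)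
    (hv0 : v ≠ 0) : ∃ q : V, (∀ c : ℝ, q ≠ c • v) ∧
      q ∈ closure {x | ∃ s : ℝ, x + s • v ∈ C} ∧ -q ∈ closure {x | ∃ s : ℝ, x + s • v ∈ C} := by
  by_contra! hno
  set D : Set V := {x | ∃ s : ℝ, x + s • v ∈ C} with hD
  have hsub : C ⊆ D := fun x hx => ⟨0, by simpa using hx⟩
  obtain ⟨l, hl⟩ := hC.salient
  have hlcl : ∀ x ∈ closure C, ‖x‖ ≤ l x := fun x hx =>
    closure_minimal hl (isClosed_le continuous_norm l.continuous) hx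
  have hlv : 0 < l v := (norm_pos_iff.2 hv0).trans_le (hlcl v hv)
  let φ : V →L[ℝ] ℝ := (l v)⁻¹ • l
  have hφv : φ v = 1 := by simp [φ, hlv.ne']
  obtain ⟨x₀, hx₀⟩ := hC.nonempty
  have hl0 : ∀ x ∈ C, 0 ≤ l x := fun x hx => (norm_nonneg x).trans (hl x hx)
  have hφ0 : ∀ x ∈ C, 0 < φ x := by
    intro x hx
    by_contra! h
    have h1 : l x ≤ 0 := by
      have : φ x = (l v)⁻¹ * l x := rfl
      rw [this] at h
      exact nonpos_of_mul_nonpos_right h (by positivity)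
    have hx0 : x = 0 := norm_le_zero_iff.1 ((hl x hx).trans h1)
    subst hx0
    have hm := hC.isOpen.mem_nhds hx
    have hc : Tendsto (fun t : ℝ => t • (-v)) (nhdsWithin 0 (Ioi 0)) (nhds 0) := by
      have : Continuous fun t : ℝ => t • (-v) := by fun_prop
      simpa using (this.tendsto 0).mono_left nhdsWithin_le_nhds
    obtain ⟨t, ht, ht0⟩ := ((hc.eventually hm).and eventually_mem_nhdsWithin).exists
    have h3 := hl0 _ ht
    have h4 : (0 : ℝ) < t := ht0
    rw [map_smul, map_neg, smul_eq_mul] at h3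
    nlinarith
  obtain ⟨r, hr, hball⟩ := Metric.isOpen_iff.1 hC.isOpen x₀ hx₀
  have hpos : ∀ n : ℕ, (0 : ℝ) < n + 1 := fun n => by positivity
  let a : ℕ → V ≃L[ℝ] V := fun n => stretch φ v hφv (n + 1) (hpos n).ne'
  have ha : ∀ n y, a n y = y + (n * φ y) • v := fun n y => by
    simp only [a]; rw [stretch_apply, add_sub_cancel_right]
  have hφa : ∀ n y, φ (a n y) = (n + 1) * φ y := fun n y => by
    rw [ha, map_add, map_smul, hφv, smul_eq_mul]; ring
  have hDsmul : ∀ t : ℝ, 0 < t → ∀ x ∈ D, t • x ∈ D := by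
    rintro t ht x ⟨s, hs⟩
    refine ⟨t * s, ?_⟩
    have := hC.smul_mem t ht _ hs
    rwa [smul_add, smul_smul] at this
  let F : Ultrafilter ℕ := hyperfilter ℕ
  have hFtop : (F : Filter ℕ) ≤ atTop := Nat.hyperfilter_le_atTop
  obtain ⟨C', hC', hcl, hlim⟩ := hC.exists_limit F a (x := fun _ => x₀) (R := ‖x₀‖) hr
    (fun _ => le_rfl) (fun n y hy => by
      have hy' : y ∈ C := hball (by simpa [dist_eq_norm] using hy)
      rw [ha]
      exact hC.add_closure_mem hy'
        (hC.smul_mem_closure (mul_nonneg n.cast_nonneg (hφ0 y hy').le) hv))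
    (P := closure D ∩ {x | 0 ≤ φ x})
    (isClosed_closure.inter (isClosed_le continuous_const φ.continuous))
    (fun t ht x hx => ⟨map_mem_closure (by fun_prop : Continuous fun x : V => t • x) hx.1
      (hDsmul t ht), by
        have : 0 ≤ φ x := hx.2
        simp only [mem_ofPred_eq, map_smul, smul_eq_mul]; positivity⟩)
    (fun x hx hx' => by
      have h0 : φ x = 0 := by
        have h1 : 0 ≤ φ x := hx.2
        have h2 : 0 ≤ φ (-x) := hx'.2
        rw [map_neg] at h2
        linarith
      by_contra hne
      refine hno x (fun c hc => ?_) hx.1 hx'.1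
      rw [hc, map_smul, hφv, smul_eq_mul, mul_one] at h0
      rw [h0, zero_smul] at hc
      exact hne hc)
    (fun n y hy => by
      refine ⟨subset_closure ⟨n * φ y, by rw [← ha]; exact hy⟩, ?_⟩
      have := hφ0 _ hy
      rw [hφa] at this
      exact (pos_of_mul_pos_right this (hpos n).le).le)
  have hmem : ∀ y ∈ C', ∃ n, a n y ∈ C := fun y hy =>
    (hlim _ y tendsto_const_nhds hy).exists
  have hφC' : ∀ y ∈ C', 0 < φ y := fun y hy => by
    obtain ⟨n, hn⟩ := hmem y hy
    have := hφ0 _ hn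
    rw [hφa] at this
    exact pos_of_mul_pos_right this (hpos n).le
  have hDopen : IsOpen D := by
    have : D = ⋃ s : ℝ, {x | x + s • v ∈ C} := by ext; simp [hD]
    rw [this]
    exact isOpen_iUnion fun s => hC.isOpen.preimage (by fun_prop)
  have hA : {z | 0 < φ z} ∩ D ⊆ C' := by
    refine hC'.subset_of_subset_closure
      ((isOpen_lt continuous_const φ.continuous).inter hDopen) ?_
    rintro z ⟨hz, s, hs⟩
    refine hcl (fun _ => z) z tendsto_const_nhds (hFtop ?_)
    have hz' : 0 < φ z := hz
    filter_upwards [eventually_ge_atTop ⌈s / φ z⌉₊] with n hn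
    have h3 : s ≤ n * φ z := (div_le_iff₀ hz').1 (Nat.ceil_le.1 hn)
    refine subset_closure ?_
    have := hC.add_closure_mem hs (hC.smul_mem_closure (sub_nonneg.2 h3) hv)
    rw [ha]
    convert this using 1
    module
  obtain ⟨y, hy, s, h1, h2⟩ := hC'.irreducible φ v hφv hφC'
  refine h2 (hA ⟨h1, ?_⟩)
  obtain ⟨n, hn⟩ := hmem y hy
  rw [ha] at hn
  exact ⟨n * φ y - s, by convert hn using 1; module⟩

end IsDivisibleCone

namespace IsDivisibleCone

variable {V : Type*} [NormedAddCommGroup V] [NormedSpace ℝ V] {C : Set V}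

/-- A divisible cone has no faces of codimension one. -/
theorem not_eventually_mem_closure [FiniteDimensional ℝ V] (hC : IsDivisibleCone C)
    {φ : V →L[ℝ] ℝ} (hφ : ∀ x ∈ C, 0 < φ x) {w₀ : V} (hw₀ : φ w₀ = 0) :
    ¬ ∀ᶠ w in nhds w₀, φ w = 0 → w ∈ closure C := by
  intro hface
  wlog hnorm : ∃ o ∈ C, φ o = 1 generalizing φ
  · obtain ⟨o, ho⟩ := hC.nonempty
    have h0 := hφ o ho
    refine this (φ := (φ o)⁻¹ • φ) (fun x hx => ?_) (by simp [hw₀]) ?_ ⟨o, ho, by simp [h0.ne']⟩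
    · have := hφ x hx
      simp only [smul_apply, smul_eq_mul]
      positivity
    · filter_upwards [hface] with w hw hw'
      exact hw (by simpa [h0.ne'] using hw')
  obtain ⟨o, ho, hφo⟩ := hnorm
  obtain ⟨l, hl⟩ := hC.salient
  have hcpos : ∀ n : ℕ, (0 : ℝ) < 1 / ((n : ℝ) + 1) := fun n => by positivity
  have hcle : ∀ n : ℕ, 1 / ((n : ℝ) + 1) ≤ 1 := fun n => by
    rw [div_le_one (by positivity)]; linarith [n.cast_nonneg (α := ℝ)]
  let c : ℕ → ℝ := fun n => 1 / ((n : ℝ) + 1)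
  have hc0 : Tendsto c atTop (nhds 0) := tendsto_one_div_add_atTop_nhds_zero_nat
  let a : ℕ → V ≃L[ℝ] V := fun n => stretch φ o hφo (c n) (hcpos n).ne'
  have ha : ∀ n y, a n y = (y - φ y • o) + (c n * φ y) • o := fun n y => by
    simp only [a]; rw [stretch_apply]; module
  have hφa : ∀ n y, φ (a n y) = c n * φ y := fun n y => by
    rw [ha, map_add, map_sub, map_smul, map_smul, hφo, smul_eq_mul, smul_eq_mul]; ring
  have hev : ∀ᶠ y in nhds (w₀ + o), 0 < φ y ∧ y - φ y • o ∈ closure C := by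
    have h1 : φ (w₀ + o) = 1 := by rw [map_add, hw₀, hφo, zero_add]
    have h2 : ∀ᶠ y in nhds (w₀ + o), 0 < φ y :=
      φ.continuous.continuousAt.eventually (lt_mem_nhds (by rw [h1]; exact one_pos))
    have h3 : Tendsto (fun y : V => y - φ y • o) (nhds (w₀ + o)) (nhds w₀) := by
      have : Continuous fun y : V => y - φ y • o := by fun_prop
      simpa [h1] using this.tendsto (w₀ + o)
    filter_upwards [h2, h3.eventually hface] with y hy hy'
    exact ⟨hy, hy' (by rw [map_sub, map_smul, hφo, smul_eq_mul, mul_one, sub_self])⟩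
  obtain ⟨r, hr, hball⟩ := Metric.eventually_nhds_iff.1 hev
  let F : Ultrafilter ℕ := hyperfilter ℕ
  have hFtop : (F : Filter ℕ) ≤ atTop := Nat.hyperfilter_le_atTop
  obtain ⟨C', hC', hcl, hlim⟩ := hC.exists_limit F a (x := fun _ => w₀ + o) (R := ‖w₀ + o‖) hr
    (fun _ => le_rfl) (fun n y hy => by
      obtain ⟨h1, h2⟩ := hball (y := y) (by simpa [dist_eq_norm] using hy)
      rw [ha, add_comm]
      exact hC.add_closure_mem (hC.smul_mem _ (mul_pos (hcpos n) h1) _ ho) h2)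
    (P := {y | ‖y‖ ≤ l y}) (isClosed_le continuous_norm l.continuous)
    (fun t ht x hx => by
      have : ‖x‖ ≤ l x := hx
      simp only [mem_ofPred_eq, map_smul, smul_eq_mul, norm_smul, Real.norm_of_nonneg ht.le]
      gcongr)
    (fun x hx hx' => by
      have h1 : ‖x‖ ≤ l x := hx
      have h2 : ‖-x‖ ≤ l (-x) := hx'
      rw [norm_neg, map_neg] at h2
      exact norm_le_zero_iff.1 (by linarith))
    (fun n y hy => by
      have h1 := hφ _ hy
      rw [hφa] at h1
      have h2 : 0 < φ y := pos_of_mul_pos_right h1 (hcpos n).le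
      have h3 : 0 ≤ (1 - c n) * φ y := mul_nonneg (sub_nonneg.2 (hcle n)) h2.le
      have := hC.add_closure_mem hy (hC.smul_mem_closure h3 (subset_closure ho))
      rw [ha] at this
      refine hl y ?_
      convert this using 1
      module)
  have hφC' : ∀ y ∈ C', 0 < φ y := fun y hy => by
    obtain ⟨n, hn⟩ := (hlim _ y tendsto_const_nhds hy).exists
    have := hφ _ hn
    rw [hφa] at this
    exact pos_of_mul_pos_right this (hcpos n).le
  obtain ⟨y, hy, s, h1, h2⟩ := hC'.irreducible φ o hφo hφC'
  refine h2 ?_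
  have hopen : IsOpen ({z | 0 < φ z} ∩ ⋃ s : ℝ, {z | z + s • o ∈ C'}) :=
    (isOpen_lt continuous_const φ.continuous).inter
      (isOpen_iUnion fun s => hC'.isOpen.preimage (by fun_prop))
  refine hC'.subset_of_subset_closure hopen ?_ ⟨h1, mem_iUnion.2 ⟨-s, ?_⟩⟩
  · rintro z ⟨hz, hz'⟩
    obtain ⟨s, hs⟩ := mem_iUnion.1 hz'
    have hz0 : 0 < φ z := hz
    have hmem : z - φ z • o ∈ closure C := by
      have hT : Tendsto (fun n => a n (z + s • o)) F (nhds (z - φ z • o)) := by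
        have : Tendsto (fun n => (z + s • o - φ (z + s • o) • o) + (c n * φ (z + s • o)) • o) atTop
            (nhds ((z + s • o - φ (z + s • o) • o) + ((0 : ℝ) * φ (z + s • o)) • o)) :=
          ((hc0.mul_const _).smul_const o).const_add _
        simp_rw [ha]
        convert this.mono_left hFtop using 2
        rw [map_add, map_smul, hφo, smul_eq_mul]
        module
      exact mem_closure_of_tendsto hT (hlim _ _ tendsto_const_nhds hs)
    refine hcl (fun _ => z) z tendsto_const_nhds (Eventually.of_forall fun n => subset_closure ?_)
    rw [ha, add_comm]
    exact hC.add_closure_mem (hC.smul_mem _ (mul_pos (hcpos n) hz0) _ ho) hmem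
  · simpa using hy

end IsDivisibleCone

/-- The vectors `v i` span a simplicial cone properly embedded in `C`. -/
structure IsConeFlat {V ι : Type*} [NormedAddCommGroup V] [NormedSpace ℝ V] [Fintype ι] (C : Set V)
    (v : ι → V) : Prop where
  mem : ∀ i, v i ∈ closure C
  sum_mem : ∑ i, v i ∈ C
  facet : ∀ (j : ι) (a : ι → ℝ), (∀ i, 0 ≤ a i) → a j = 0 → ∑ i, a i • v i ∉ C

/-- A basis `v`, `p` with dual basis `f`, `η` such that each `v i` lies in the closure of `C` and
each `f i` is positive on `C`. -/
structure IsAdapted {V ι : Type*} [NormedAddCommGroup V] [NormedSpace ℝ V] [Fintype ι]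
    [DecidableEq ι] (C : Set V) (v : ι → V) (f : ι → V →L[ℝ] ℝ) (p : V) (η : V →L[ℝ] ℝ) :
    Prop where
  mem : ∀ i, v i ∈ closure C
  pos : ∀ j, ∀ x ∈ C, 0 < f j x
  dual : ∀ j i, f j (v i) = if i = j then 1 else 0
  apply_p : ∀ j, f j p = 0
  normal_p : η p = 1
  normal_v : ∀ i, η (v i) = 0
  expand : ∀ x, x = η x • p + ∑ i, f i x • v i

theorem IsConeFlat.exists_adapted {V ι : Type*} [NormedAddCommGroup V] [NormedSpace ℝ V]
    [FiniteDimensional ℝ V] [Fintype ι] [DecidableEq ι] {C : Set V} {v : ι → V}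
    (hv : IsConeFlat C v) (hC : IsOpenCone C) (hdim : Module.finrank ℝ V = Fintype.card ι + 1) :
    ∃ f p η, IsAdapted C v f p η := by
  have key : ∀ j, ∃ f : V →L[ℝ] ℝ, (∀ x ∈ C, 0 < f x) ∧
      ∀ i, f (v i) = if i = j then 1 else 0 := by
    intro j
    have e : ∑ i ∈ Finset.univ.erase j, v i = ∑ i, (if i = j then (0 : ℝ) else 1) • v i := by
      simp [ite_smul, Finset.sum_ite, Finset.filter_ne']
    have h1 : ∑ i ∈ Finset.univ.erase j, v i ∈ closure C := by
      simpa using hC.sum_mem_closure (Finset.univ.erase j) (a := fun _ => 1)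
        (fun _ _ => zero_le_one) fun i _ => hv.mem i
    have h2 : ∑ i ∈ Finset.univ.erase j, v i ∉ C := by
      rw [e]
      exact hv.facet j _ (fun i => by split_ifs <;> norm_num) (by simp)
    obtain ⟨g, hg, hg0⟩ := hC.exists_support h1 h2
    have hg' : ∀ i ≠ j, g (v i) = 0 := by
      rw [map_sum, Finset.sum_eq_zero_iff_of_nonneg fun i _ =>
        IsOpenCone.nonneg_of_mem_closure (fun x hx => (hg x hx).le) (hv.mem i)] at hg0
      exact fun i hi => hg0 i (by simp [hi])
    have hgj : 0 < g (v j) := by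
      have := hg _ hv.sum_mem
      rwa [map_sum, Finset.sum_eq_single j (fun i _ hi => hg' i hi) (by simp)] at this
    refine ⟨(g (v j))⁻¹ • g, fun x hx => ?_, fun i => ?_⟩
    · have := hg x hx
      simp only [smul_apply, smul_eq_mul]
      positivity
    · split_ifs with h
      · subst h; simp [hgj.ne']
      · simp [hg' i h]
  choose f hf hdual using key
  let T : V →ₗ[ℝ] (ι → ℝ) := LinearMap.pi fun j => (f j : V →ₗ[ℝ] ℝ)
  have hT : ∀ x j, T x j = f j x := fun _ _ => rfl
  have hsurj : LinearMap.range T = ⊤ := by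
    refine LinearMap.range_eq_top.2 fun a => ⟨∑ i, a i • v i, ?_⟩
    ext j
    rw [hT]
    simp [hdual]
  have hker : Module.finrank ℝ (LinearMap.ker T) = 1 := by
    have := T.finrank_range_add_finrank_ker
    rw [hsurj, finrank_top, Module.finrank_fintype_fun_eq_card] at this
    omega
  obtain ⟨⟨p, hp⟩, hp0, hspan⟩ := finrank_eq_one_iff'.1 hker
  have hp0' : p ≠ 0 := fun h => hp0 (by simpa using h)
  have hfp : ∀ j, f j p = 0 := fun j => by
    rw [← hT, LinearMap.mem_ker.1 hp]; rfl
  obtain ⟨η₀, hη₀⟩ := SeparatingDual.exists_eq_one (R := ℝ) hp0'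
  let η : V →L[ℝ] ℝ := η₀ - ∑ j, η₀ (v j) • f j
  have hη : ∀ x, η x = η₀ x - ∑ j, η₀ (v j) * f j x := fun x => by
    simp [η]
  refine ⟨f, p, η, hv.mem, hf, fun j i => hdual j i, hfp, by simp [hη, hfp, hη₀],
    fun i => by simp [hη, hdual], fun x => ?_⟩
  have hx : x - ∑ i, f i x • v i ∈ LinearMap.ker T := by
    rw [LinearMap.mem_ker]
    ext j
    rw [hT]
    simp [hdual]
  obtain ⟨c, hc⟩ := hspan ⟨_, hx⟩
  have hc' : c • p = x - ∑ i, f i x • v i := congrArg Subtype.val hc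
  have : η x = c := by
    have := congrArg η₀ hc'
    rw [map_smul, hη₀, smul_eq_mul, mul_one, map_sub, map_sum] at this
    rw [this, hη]
    simp [mul_comm]
  rw [this, hc']
  abel

namespace IsAdapted

variable {V ι : Type*} [NormedAddCommGroup V] [NormedSpace ℝ V]
  [Fintype ι] [DecidableEq ι] {C : Set V} {v : ι → V} {f : ι → V →L[ℝ] ℝ} {p : V} {η : V →L[ℝ] ℝ}

theorem nonneg (h : IsAdapted C v f p η) (j : ι) {x : V} (hx : x ∈ closure C) : 0 ≤ f j x :=
  IsOpenCone.nonneg_of_mem_closure (fun x hx => (h.pos j x hx).le) hx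

theorem p_ne_zero (h : IsAdapted C v f p η) : p ≠ 0 := by
  rintro rfl
  simpa using h.normal_p

theorem neg (h : IsAdapted C v f p η) : IsAdapted C v f (-p) (-η) where
  mem := h.mem
  pos := h.pos
  dual := h.dual
  apply_p j := by simp [h.apply_p]
  normal_p := by simp [h.normal_p]
  normal_v i := by simp [h.normal_v]
  expand x := by simpa using h.expand x

theorem p_notMem_closure [FiniteDimensional ℝ V] (h : IsAdapted C v f p η)
    (hC : IsDivisibleCone C) : p ∉ closure C := by
  intro hp
  obtain ⟨q, hq, hq1, hq2⟩ := hC.exists_line hp h.p_ne_zero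
  have key : ∀ j, ∀ x ∈ closure {x | ∃ s : ℝ, x + s • p ∈ C}, 0 ≤ f j x := fun j x hx =>
    IsOpenCone.nonneg_of_mem_closure (fun x hx => by
      obtain ⟨s, hs⟩ := hx
      have := h.pos j _ hs
      rw [map_add, map_smul, h.apply_p, smul_zero, add_zero] at this
      exact this.le) hx
  have h0 : ∀ j, f j q = 0 := fun j => le_antisymm
    (by simpa using key j _ hq2) (key j _ hq1)
  apply hq (η q)
  have := h.expand q
  simpa [h0] using this

theorem apply_p_eq_zero [FiniteDimensional ℝ V] (h : IsAdapted C v f p η) (hC : IsDivisibleCone C)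
    {g : V →L[ℝ] ℝ} (hg : ∀ x ∈ C, 0 ≤ g x) {k : ι} (hk : g (v k) = 0) : g p = 0 := by
  have hvk : v k ≠ 0 := fun h0 => by
    have := h.dual k k
    simp [h0] at this
  obtain ⟨q, hq, hq1, hq2⟩ := hC.exists_line (h.mem k) hvk
  have key : ∀ g : V →L[ℝ] ℝ, (∀ x ∈ C, 0 ≤ g x) → g (v k) = 0 → g q = 0 := by
    intro g hg hgk
    have : ∀ x ∈ closure {x | ∃ s : ℝ, x + s • v k ∈ C}, 0 ≤ g x := fun x hx =>
      IsOpenCone.nonneg_of_mem_closure (fun x hx => by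
        obtain ⟨s, hs⟩ := hx
        have := hg _ hs
        rwa [map_add, map_smul, hgk, smul_zero, add_zero] at this) hx
    exact le_antisymm (by simpa using this _ hq2) (this _ hq1)
  have hq0 : q = η q • p + f k q • v k := by
    conv_lhs => rw [h.expand q]
    rw [Finset.sum_eq_single k _ (by simp)]
    intro j _ hj
    rw [key (f j) (fun x hx => (h.pos j x hx).le) (by simp [h.dual, hj.symm]), zero_smul]
  have hηq : η q ≠ 0 := fun h0 => hq (f k q) (by simpa [h0] using hq0)
  have h1 := key g hg hk
  rw [hq0, map_add, map_smul, map_smul, hk, smul_zero, add_zero, smul_eq_mul] at h1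
  exact (mul_eq_zero.1 h1).resolve_left hηq

theorem exists_norm_le [FiniteDimensional ℝ V] (h : IsAdapted C v f p η)
    (hC : IsDivisibleCone C) : ∃ ε : ℝ, 0 < ε ∧ ∀ x ∈ closure C, ε * ‖x‖ ≤ ∑ j, f j x := by
  have hS : IsCompact (sphere (0 : V) 1 ∩ closure C) :=
    (isCompact_sphere 0 1).inter_right isClosed_closure
  obtain ⟨ε, hε, hεS⟩ : ∃ ε : ℝ, 0 < ε ∧ ∀ x ∈ sphere (0 : V) 1 ∩ closure C, ε ≤ ∑ j, f j x := by
    rcases (sphere (0 : V) 1 ∩ closure C).eq_empty_or_nonempty with he | hne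
    · exact ⟨1, one_pos, by simp [he]⟩
    · obtain ⟨x, ⟨hx1, hx⟩, hmin⟩ := hS.exists_isMinOn hne
        (f := fun x => ∑ j, f j x) (by fun_prop)
      refine ⟨∑ j, f j x, ?_, fun y hy => hmin hy⟩
      refine (Finset.sum_nonneg fun j _ => h.nonneg j hx).lt_of_ne' fun h0 => ?_
      rw [Finset.sum_eq_zero_iff_of_nonneg fun j _ => h.nonneg j hx] at h0
      have hx0 : x = η x • p := by
        conv_lhs => rw [h.expand x]
        simp [fun j => h0 j (Finset.mem_univ j)]
      have hxne : x ≠ 0 := by rintro rfl; simp at hx1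
      rcases lt_trichotomy (η x) 0 with h1 | h1 | h1
      · refine h.neg.p_notMem_closure hC ?_
        have := hC.smul_mem_closure (t := (-η x)⁻¹) (by rw [inv_nonneg]; linarith) hx
        rw [hx0, smul_smul] at this
        convert this using 1
        simp [h.normal_p, inv_neg, h1.ne]
      · exact hxne (by rw [hx0, h1, zero_smul])
      · refine h.p_notMem_closure hC ?_
        have := hC.smul_mem_closure (t := (η x)⁻¹) (by positivity) hx
        rw [hx0, smul_smul] at this
        convert this using 1
        simp [h.normal_p, h1.ne']
  refine ⟨ε, hε, fun x hx => ?_⟩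
  rcases eq_or_ne x 0 with rfl | hx0
  · simp
  have hx' : 0 < ‖x‖ := norm_pos_iff.2 hx0
  have := hεS (‖x‖⁻¹ • x) ⟨by simp [norm_smul, hx'.ne'],
    hC.smul_mem_closure (by positivity) hx⟩
  simp only [map_smul, smul_eq_mul, ← Finset.mul_sum] at this
  calc ε * ‖x‖ ≤ (‖x‖⁻¹ * ∑ j, f j x) * ‖x‖ := by gcongr
    _ = ∑ j, f j x := by field_simp

/-- The vertices of a simplicial cone properly embedded in a divisible cone are the only boundary
points on the corresponding intersections of supporting hyperplanes. -/
theorem eq_smul_of_apply_eq_zero [FiniteDimensional ℝ V] [Nontrivial ι] (h : IsAdapted C v f p η)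
    (hC : IsDivisibleCone C) {i₀ : ι} {w : V} (hw : w ∈ closure C)
    (hw0 : ∀ j ≠ i₀, f j w = 0) : w = f i₀ w • v i₀ := by
  have hexp : w = η w • p + f i₀ w • v i₀ := by
    conv_lhs => rw [h.expand w]
    rw [Finset.sum_eq_single i₀ (fun j _ hj => by rw [hw0 j hj, zero_smul]) (by simp)]
  by_contra hne
  have hη : η w ≠ 0 := fun h0 => hne (by simpa [h0] using hexp)
  obtain ⟨j₀, hj₀⟩ := exists_ne i₀
  let b : ι → V → ℝ := fun i x => f i x - η x / η w * f i w
  let w₀ : V := w + ∑ i ∈ Finset.univ.erase j₀, v i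
  have hf₀ : ∀ i, f i w₀ = f i w + if i = j₀ then 0 else 1 := by
    intro i
    by_cases hi : i = j₀
    · simp [w₀, h.dual, hi]
    · simp [w₀, h.dual, hi, Ne.symm hi]
  have hη₀ : η w₀ = η w := by simp [w₀, h.normal_v]
  refine hC.not_eventually_mem_closure (h.pos j₀) (w₀ := w₀) (by simp [hf₀, hw0 j₀ hj₀]) ?_
  have h1 : ∀ᶠ x in nhds w₀, 0 < η x / η w := by
    have : ContinuousAt (fun x => η x / η w) w₀ := by fun_prop
    exact this.eventually (lt_mem_nhds (by simp [hη₀, hη]))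
  have h2 : ∀ᶠ x in nhds w₀, ∀ i, i ≠ j₀ → 0 < b i x := by
    rw [eventually_all]
    intro i
    by_cases hi : i = j₀
    · simp [hi]
    have : ContinuousAt (b i) w₀ := by fun_prop
    filter_upwards [this.eventually (lt_mem_nhds (a := 0) (by simp [b, hη₀, hf₀, hη, hi]))]
      with x hx _ using hx
  filter_upwards [h1, h2] with x hx1 hx2 hx0
  have hx : x = (η x / η w) • w + ∑ i, b i x • v i := by
    have e : ∑ i, b i x • v i = ∑ i, f i x • v i - (η x / η w) • ∑ i, f i w • v i := by
      rw [Finset.smul_sum, ← Finset.sum_sub_distrib]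
      exact Finset.sum_congr rfl fun i _ => by simp only [b]; module
    have e1 := h.expand x
    have e2 := h.expand w
    have e3 : ∑ i, f i w • v i = w - η w • p := eq_sub_of_add_eq' e2.symm
    have e4 : ∑ i, f i x • v i = x - η x • p := eq_sub_of_add_eq' e1.symm
    rw [e, e3, e4, smul_sub, smul_smul, div_mul_cancel₀ _ hη]
    abel
  rw [hx]
  refine hC.add_mem_closure (hC.smul_mem_closure hx1.le hw)
    (hC.sum_mem_closure _ (fun i _ => ?_) fun i _ => h.mem i)
  by_cases hi : i = j₀
  · subst hi
    simp [b, hx0, hw0 i hj₀]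
  · exact (hx2 i hi).le

/-- Maximal width of a divisible cone over a multiple of the flat direction `t`. -/
theorem exists_width [FiniteDimensional ℝ V] (h : IsAdapted C v f p η) (hC : IsDivisibleCone C)
    (hs : ∑ i, v i ∈ C) {t : ι → ℝ} (ht : ∀ i, 0 < t i) :
    ∃ e ∈ closure C, (∀ i, f i e = t i) ∧ η e ≠ 0 ∧
      ∀ x ∈ closure C, ∀ m : ℝ, 0 < m → (∀ i, f i x ≤ m * t i) → |η x| ≤ |η e| * m := by
  obtain ⟨ε, hε, hεC⟩ := h.exists_norm_le hC
  let S : Set V := closure C ∩ {x | ∀ i, f i x = t i}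
  have hScl : IsClosed S := by
    refine isClosed_closure.inter ?_
    have : {x | ∀ i, f i x = t i} = ⋂ i, {x | f i x = t i} := by ext; simp
    rw [this]
    exact isClosed_iInter fun i => isClosed_eq (f i).continuous continuous_const
  have hS : IsCompact S := by
    refine (isCompact_closedBall (0 : V) ((∑ i, t i) / ε)).of_isClosed_subset hScl ?_
    rintro x ⟨hx, hxt⟩
    have := hεC x hx
    simp only [show ∀ i, f i x = t i from hxt] at this
    rw [mem_closedBall_zero_iff, le_div_iff₀ hε, mul_comm]
    exact this
  have hz : ∑ i, t i • v i ∈ C := hC.sum_smul_mem_of_pos hs h.mem ht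
  have hlim : Tendsto (fun s : ℝ => ∑ i, t i • v i + s • p) (nhdsWithin 0 (Ioi 0))
      (nhds (∑ i, t i • v i)) := by
    have : Continuous fun s : ℝ => ∑ i, t i • v i + s • p := by fun_prop
    simpa using (this.tendsto 0).mono_left nhdsWithin_le_nhds
  obtain ⟨s, hsC, hs0⟩ :=
    ((hlim.eventually (hC.isOpen.mem_nhds hz)).and eventually_mem_nhdsWithin).exists
  have hfs : ∀ i, f i (∑ i, t i • v i + s • p) = t i := by simp [h.dual, h.apply_p]
  have hηs : η (∑ i, t i • v i + s • p) = s := by simp [h.normal_v, h.normal_p]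
  obtain ⟨e, he, hmax⟩ := hS.exists_isMaxOn ⟨_, subset_closure hsC, hfs⟩
    (f := fun x => |η x|) (by fun_prop)
  refine ⟨e, he.1, he.2, fun h0 => ?_, fun x hx m hm hxm => ?_⟩
  · have h1 : |η (∑ i, t i • v i + s • p)| ≤ |η e| := hmax ⟨subset_closure hsC, hfs⟩
    rw [hηs, h0, abs_zero] at h1
    have h2 : (0 : ℝ) < s := hs0
    exact h2.ne' (abs_nonpos_iff.1 h1)
  · have hx' : m⁻¹ • (x + ∑ i, (m * t i - f i x) • v i) ∈ S := by
      refine ⟨hC.smul_mem_closure (by positivity) (hC.add_mem_closure hx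
        (hC.sum_mem_closure _ (fun i _ => sub_nonneg.2 (hxm i)) fun i _ => h.mem i)), fun i => ?_⟩
      simp [h.dual]
      field_simp
      ring
    have h1 : |η (m⁻¹ • (x + ∑ i, (m * t i - f i x) • v i))| ≤ |η e| := hmax hx'
    simp only [map_smul, map_add, map_sum, h.normal_v, mul_zero, Finset.sum_const_zero, add_zero,
      smul_eq_mul, abs_mul, abs_inv, abs_of_pos hm] at h1
    rwa [inv_mul_le_iff₀ hm, mul_comm] at h1

end IsAdapted

namespace IsAdapted

variable {V ι : Type*} [NormedAddCommGroup V] [NormedSpace ℝ V]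
  [Fintype ι] [DecidableEq ι] {C : Set V} {v : ι → V} {f : ι → V →L[ℝ] ℝ} {p : V} {η : V →L[ℝ] ℝ}

theorem ext_coord (h : IsAdapted C v f p η) {x y : V} (hη : η x = η y) (hf : ∀ i, f i x = f i y) :
    x = y := by
  rw [h.expand x, h.expand y, hη]
  simp [hf]

theorem exists_diagonal (h : IsAdapted C v f p η) {s : ℝ} (hs : s ≠ 0) {c : ι → ℝ}
    (hc : ∀ i, c i ≠ 0) :
    ∃ a : V ≃L[ℝ] V, (∀ y, η (a y) = s * η y) ∧ ∀ i y, f i (a y) = c i * f i y := by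
  let D : ℝ → (ι → ℝ) → V →L[ℝ] V := fun s c => s • η.smulRight p + ∑ i, c i • (f i).smulRight (v i)
  have hDη : ∀ s c y, η (D s c y) = s * η y := fun s c y => by
    simp [D, h.normal_p, h.normal_v]
  have hDf : ∀ s c i y, f i (D s c y) = c i * f i y := fun s c i y => by
    simp [D, h.apply_p, h.dual]
  exact ⟨ContinuousLinearEquiv.equivOfInverse (D s c) (D s⁻¹ fun i => (c i)⁻¹)
    (fun y => h.ext_coord (by rw [hDη, hDη, inv_mul_cancel_left₀ hs])
      fun i => by rw [hDf, hDf, inv_mul_cancel_left₀ (hc i)])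
    (fun y => h.ext_coord (by rw [hDη, hDη, mul_inv_cancel_left₀ hs])
      fun i => by rw [hDf, hDf, mul_inv_cancel_left₀ (hc i)]), hDη s c, hDf s c⟩

/-- Blowing up a divisible cone along the diagonal directions of a flat. -/
theorem exists_blowup [FiniteDimensional ℝ V] [Nonempty ι] (h : IsAdapted C v f p η)
    (hC : IsDivisibleCone C) (hs : ∑ i, v i ∈ C) {α : Type*} (F : Ultrafilter α) {t : α → ι → ℝ}
    (ht : ∀ n i, 0 < t n i) :
    ∃ (a : α → V ≃L[ℝ] V) (W : α → ℝ) (C' : Set V), (∀ n, 0 < W n) ∧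
      (∀ n y, η (a n y) = W n * η y) ∧ (∀ n i y, f i (a n y) = t n i * f i y) ∧
      (∀ n, ∀ x ∈ closure C, ∀ m : ℝ, 0 < m → (∀ i, f i x ≤ m * t n i) → |η x| ≤ W n * m) ∧
      IsDivisibleCone C' ∧ IsAdapted C' v f p η ∧
      (∀ (y : α → V) (y₀ : V), Tendsto y F (nhds y₀) → (∀ᶠ n in F, a n (y n) ∈ closure C) →
        y₀ ∈ closure C') ∧
      ∀ (y : α → V) (y₀ : V), Tendsto y F (nhds y₀) → y₀ ∈ C' → ∀ᶠ n in F, a n (y n) ∈ C := by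
  choose e heC hef heη hwidth using fun n => h.exists_width hC hs (ht n)
  have hW : ∀ n, 0 < |η (e n)| := fun n => abs_pos.2 (heη n)
  choose a haη haf using fun n => h.exists_diagonal (hW n).ne' fun i => (ht n i).ne'
  let σ : α → ℝ := fun n => η (e n) / |η (e n)|
  have hσ : ∀ n, |σ n| = 1 := fun n => by simp [σ, abs_div, (hW n).ne']
  have hσ2 : ∀ n, σ n * σ n = 1 := fun n => by rw [← abs_mul_abs_self, hσ, one_mul]
  have hση : ∀ n, σ n * |η (e n)| = η (e n) := fun n => div_mul_cancel₀ _ (hW n).ne'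
  let x : α → V := fun n => (σ n / 2) • p + (2 : ℝ) • ∑ i, v i
  have hxη : ∀ n, η (x n) = σ n / 2 := fun n => by simp [x, h.normal_p, h.normal_v]
  have hxf : ∀ n i, f i (x n) = 2 := fun n i => by simp [x, h.apply_p, h.dual]
  obtain ⟨r, hr, hsmall⟩ : ∃ r > 0, ∀ w : V, ‖w‖ < r → |η w| < 1 / 2 ∧ ∀ i, |f i w| < 1 / 2 := by
    have hev : ∀ᶠ w in nhds (0 : V), |η w| < 1 / 2 ∧ ∀ i, |f i w| < 1 / 2 := by
      refine Eventually.and ?_ (eventually_all.2 fun i => ?_)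
      · have : ContinuousAt (fun w => |η w|) 0 := by fun_prop
        exact this.eventually (gt_mem_nhds (by simp))
      · have : ContinuousAt (fun w => |f i w|) 0 := by fun_prop
        exact this.eventually (gt_mem_nhds (by simp))
    obtain ⟨r, hr, hball⟩ := Metric.eventually_nhds_iff.1 hev
    exact ⟨r, hr, fun w hw => hball (by simpa using hw)⟩
  have hP : ∀ n y, a n y ∈ C → (∀ j, 0 ≤ f j y) ∧ |η y| ≤ ∑ j, f j y := by
    intro n y hy
    have h0 : ∀ j, 0 < f j y := fun j => by
      have := h.pos j _ hy
      rw [haf] at this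
      exact pos_of_mul_pos_right this (ht n j).le
    have h1 := hwidth n _ (subset_closure hy) (∑ j, f j y)
      (Finset.sum_pos (fun j _ => h0 j) Finset.univ_nonempty) fun i => by
        rw [haf, mul_comm]
        exact mul_le_mul_of_nonneg_right
          (Finset.single_le_sum (fun j _ => (h0 j).le) (Finset.mem_univ i)) (ht n i).le
    rw [haη, abs_mul, abs_abs] at h1
    exact ⟨fun j => (h0 j).le, le_of_mul_le_mul_left h1 (hW n)⟩
  obtain ⟨C', hC', hcl, hlim⟩ := hC.exists_limit F a (x := x)
    (R := ‖p‖ + ‖(2 : ℝ) • ∑ i, v i‖) hr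
    (fun n => by
      refine (norm_add_le _ _).trans (add_le_add_left ?_ _)
      rw [norm_smul, Real.norm_eq_abs, abs_div, hσ]
      norm_num
      linarith [norm_nonneg p])
    (fun n y hy => by
      obtain ⟨h1, h2⟩ := hsmall _ hy
      have h3 : |σ n * η (y - x n)| < 1 / 2 := by rwa [abs_mul, hσ, one_mul]
      have h4 : σ n * η (y - x n) = σ n * η y - 1 / 2 := by
        rw [map_sub, hxη, mul_sub, mul_div_assoc', hσ2]
      rw [h4, abs_lt] at h3
      have h5 : ∀ i, 3 / 2 < f i y := fun i => by
        have := (abs_lt.1 (h2 i)).1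
        rw [map_sub, hxf] at this
        linarith
      have key : a n y = ∑ i, (t n i * (f i y - σ n * η y)) • v i + (σ n * η y) • e n := by
        refine h.ext_coord ?_ fun i => ?_
        · rw [haη, map_add, map_smul, map_sum]
          simp only [map_smul, h.normal_v, mul_zero, Finset.sum_const_zero, zero_add,
            smul_eq_mul]
          linear_combination (-|η (e n)| * η y) * hσ2 n + σ n * η y * hση n
        · rw [haf, map_add, map_smul, map_sum]
          simp [h.dual, hef]
          ring
      rw [key]
      exact hC.add_closure_mem (hC.sum_smul_mem_of_pos hs h.mem fun i =>
        mul_pos (ht n i) (by linarith [h5 i])) (hC.smul_mem_closure (by linarith) (heC n)))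
    (P := {y | (∀ j, 0 ≤ f j y) ∧ |η y| ≤ ∑ j, f j y})
    (by
      have : {y | (∀ j, 0 ≤ f j y) ∧ |η y| ≤ ∑ j, f j y} =
          (⋂ j, {y | 0 ≤ f j y}) ∩ {y | |η y| ≤ ∑ j, f j y} := by ext; simp
      rw [this]
      exact (isClosed_iInter fun j => isClosed_le continuous_const (f j).continuous).inter
        (isClosed_le (by fun_prop) (by fun_prop)))
    (fun s hs x hx => by
      refine ⟨fun j => ?_, ?_⟩
      · simpa using mul_nonneg hs.le (hx.1 j)
      · simp only [map_smul, smul_eq_mul, ← Finset.mul_sum, abs_mul, abs_of_pos hs]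
        exact mul_le_mul_of_nonneg_left hx.2 hs.le)
    (fun x hx hx' => by
      have h0 : ∀ j, f j x = 0 := fun j => le_antisymm (by simpa using hx'.1 j) (hx.1 j)
      have h1 : |η x| ≤ ∑ j, f j x := hx.2
      refine h.ext_coord ?_ fun i => by simp [h0]
      simpa [h0] using h1)
    hP
  refine ⟨a, fun n => |η (e n)|, C', hW, haη, haf, hwidth, hC', ?_, hcl, hlim⟩
  refine ⟨fun i => hcl (fun _ => v i) _ tendsto_const_nhds (Eventually.of_forall fun n => ?_),
    fun j y hy => ?_, h.dual, h.apply_p, h.normal_p, h.normal_v, h.expand⟩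
  · have : a n (v i) = t n i • v i := by
      refine h.ext_coord (by simp [haη, h.normal_v]) fun j => ?_
      rw [haf, map_smul, h.dual, smul_eq_mul]
      split_ifs with hij
      · rw [hij]
      · simp
    rw [this]
    exact hC.smul_mem_closure (ht n i).le (h.mem i)
  · obtain ⟨n, hn⟩ := (hlim _ y tendsto_const_nhds hy).exists
    have := h.pos j _ hn
    rw [haf] at this
    exact pos_of_mul_pos_right this (ht n j).le

end IsAdapted

theorem IsAdapted.tendsto_of_coord {V ι : Type*} [NormedAddCommGroup V] [NormedSpace ℝ V]
    [Fintype ι] [DecidableEq ι] {C : Set V} {v : ι → V} {f : ι → V →L[ℝ] ℝ} {p : V}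
    {η : V →L[ℝ] ℝ} (h : IsAdapted C v f p η) {α : Type*} {F : Filter α} {u : α → V} {y : V}
    (hη : Tendsto (fun n => η (u n)) F (nhds (η y)))
    (hf : ∀ i, Tendsto (fun n => f i (u n)) F (nhds (f i y))) : Tendsto u F (nhds y) := by
  have : Tendsto (fun n => η (u n) • p + ∑ i, f i (u n) • v i) F
      (nhds (η y • p + ∑ i, f i y • v i)) :=
    (hη.smul_const p).add (tendsto_finsetSum _ fun i _ => (hf i).smul_const (v i))
  simpa only [← h.expand] using this

/-- In a divisible cone of dimension at least four, the edges of properly embedded simplicial cones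
of codimension one are isolated. -/
theorem IsConeFlat.eventually_eq_smul {V ι : Type*} [NormedAddCommGroup V] [NormedSpace ℝ V]
    [FiniteDimensional ℝ V] [Fintype ι] {C : Set V} {v : ι → V} (hv : IsConeFlat C v)
    (hC : IsDivisibleCone C) (hdim : Module.finrank ℝ V = Fintype.card ι + 1)
    (hcard : 3 ≤ Fintype.card ι) (i₀ : ι) :
    ∀ᶠ v' in nhds v, IsConeFlat C v' → ∃ c : ℝ, v' i₀ = c • v i₀ := by
  classical
  have : Nontrivial ι := Fintype.one_lt_card_iff_nontrivial.1 (by omega)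
  obtain ⟨f, p, η, h⟩ := hv.exists_adapted hC.toIsOpenCone hdim
  by_contra hnot
  let α : Type _ := {v' : ι → V // IsConeFlat C v' ∧ ∀ c : ℝ, v' i₀ ≠ c • v i₀}
  have hne : (comap (Subtype.val : α → ι → V) (nhds v)).NeBot := by
    rw [comap_neBot_iff_frequently]
    intro hev
    refine hnot ?_
    filter_upwards [hev] with v' h1 h2
    by_contra! h3
    exact h1 ⟨⟨v', h2, h3⟩, rfl⟩
  let F : Ultrafilter α := Ultrafilter.of (comap (Subtype.val : α → ι → V) (nhds v))
  have hval : Tendsto (Subtype.val : α → ι → V) F (nhds v) :=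
    tendsto_comap.mono_left (Ultrafilter.of_le _)
  have hvi : ∀ i, Tendsto (fun n : α => n.1 i) F (nhds (v i)) := tendsto_pi_nhds.1 hval
  let τ : α → ℝ := fun n => ∑ j ∈ Finset.univ.erase i₀, f j (n.1 i₀)
  have hτ : ∀ n, 0 < τ n := by
    intro n
    have h0 : ∀ j ∈ Finset.univ.erase i₀, 0 ≤ f j (n.1 i₀) := fun j _ => h.nonneg j (n.2.1.mem i₀)
    refine (Finset.sum_nonneg h0).lt_of_ne' fun h1 => ?_
    rw [Finset.sum_eq_zero_iff_of_nonneg h0] at h1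
    exact n.2.2 _ (h.eq_smul_of_apply_eq_zero hC (n.2.1.mem i₀) fun j hj => h1 j (by simp [hj]))
  have hτ0 : Tendsto τ F (nhds 0) := by
    have h1 : Tendsto τ F (nhds (∑ j ∈ Finset.univ.erase i₀, f j (v i₀))) :=
      tendsto_finsetSum _ fun j _ => ((f j).continuous.tendsto _).comp (hvi i₀)
    rwa [Finset.sum_eq_zero fun j hj => by
      rw [h.dual, if_neg (Finset.ne_of_mem_erase hj).symm]] at h1
  let t : α → ι → ℝ := fun n i => if i = i₀ then (τ n)⁻¹ else 1
  have ht : ∀ n i, 0 < t n i := fun n i => by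
    simp only [t]
    split_ifs
    · exact inv_pos.2 (hτ n)
    · exact one_pos
  obtain ⟨a, W, C', hW, haη, haf, hwidth, hC', h', hcl, hlim⟩ :=
    h.exists_blowup hC hv.sum_mem F ht
  have hsη : ∀ n y, η ((a n).symm y) = η y / W n := fun n y => by
    rw [eq_div_iff (hW n).ne', mul_comm, ← haη, (a n).apply_symm_apply]
  have hsf : ∀ n i y, f i ((a n).symm y) = f i y / t n i := fun n i y => by
    rw [eq_div_iff (ht n i).ne', mul_comm, ← haf, (a n).apply_symm_apply]
  obtain ⟨s, hs0, hsW⟩ : ∃ s > 0, ∀ᶠ n in F, s ≤ W n := by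
    have hT : Tendsto (fun s : ℝ => ∑ i, v i + s • p) (nhdsWithin 0 (Ioi 0))
        (nhds (∑ i, v i)) := by
      have : Continuous fun s : ℝ => ∑ i, v i + s • p := by fun_prop
      simpa using (this.tendsto 0).mono_left nhdsWithin_le_nhds
    obtain ⟨s, hsC, hs0⟩ :=
      ((hT.eventually (hC.isOpen.mem_nhds hv.sum_mem)).and eventually_mem_nhdsWithin).exists
    refine ⟨s, hs0, ?_⟩
    filter_upwards [hτ0.eventually (gt_mem_nhds one_pos)] with n hn
    have := hwidth n _ (subset_closure hsC) 1 one_pos fun i => by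
      have h1 : f i (∑ i, v i + s • p) = 1 := by simp [h.dual, h.apply_p]
      rw [h1, one_mul]
      simp only [t]
      split_ifs
      · exact (one_le_inv₀ (hτ n)).2 hn.le
      · exact le_rfl
    have h2 : η (∑ i, v i + s • p) = s := by simp [h.normal_v, h.normal_p]
    rw [h2, mul_one] at this
    exact (le_abs_self s).trans this
  have hu : ∀ i ≠ i₀, Tendsto (fun n : α => (a n).symm (n.1 i)) F (nhds (v i)) := by
    intro i hi
    refine h.tendsto_of_coord ?_ fun j => ?_
    · have h1 : Tendsto (fun n : α => |η (n.1 i)| / s) F (nhds 0) := by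
        have : Continuous fun x : V => |η x| / s := by fun_prop
        have h2 : Tendsto (fun n : α => |η (n.1 i)| / s) F (nhds (|η (v i)| / s)) :=
          (this.tendsto (v i)).comp (hvi i)
        simpa [h.normal_v] using h2
      rw [h.normal_v]
      refine squeeze_zero_norm' ?_ h1
      filter_upwards [hsW] with n hn
      rw [hsη, Real.norm_eq_abs, abs_div, abs_of_pos (hW n)]
      gcongr
    · have h1 : Tendsto (fun n : α => f j (n.1 i)) F (nhds (f j (v i))) :=
        ((f j).continuous.tendsto _).comp (hvi i)
      simp_rw [hsf]
      by_cases hj : j = i₀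
      · have h2 := h1.mul hτ0
        have h3 : f j (v i) = 0 := by rw [h.dual, if_neg (by rw [hj]; exact hi)]
        rw [h3, zero_mul] at h2
        simpa [t, hj, h3, hj ▸ h3] using h2
      · simpa [t, hj] using h1
  let u : α → V := fun n => (τ n)⁻¹ • (a n).symm (n.1 i₀)
  have hau : ∀ n, a n (u n) = (τ n)⁻¹ • n.1 i₀ := fun n => by
    simp [u]
  have hauC : ∀ n, a n (u n) ∈ closure C := fun n => by
    rw [hau]
    exact hC.smul_mem_closure (inv_pos.2 (hτ n)).le (n.2.1.mem i₀)
  have huf0 : ∀ n, f i₀ (u n) = f i₀ (n.1 i₀) := fun n => by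
    simp [u, hsf, t]
    field_simp [(hτ n).ne']
  have huf1 : ∀ n, ∑ j ∈ Finset.univ.erase i₀, f j (u n) = 1 := fun n => by
    rw [Finset.sum_congr rfl (g := fun j => (τ n)⁻¹ * f j (n.1 i₀)) fun j hj => by
      simp [u, hsf, t, Finset.ne_of_mem_erase hj], ← Finset.mul_sum]
    exact inv_mul_cancel₀ (hτ n).ne'
  have hufnn : ∀ n j, 0 ≤ f j (u n) := fun n j => by
    have := h.nonneg j (hauC n)
    rw [haf] at this
    exact nonneg_of_mul_nonneg_right this (ht n j)
  have hufs : ∀ n, ∑ j, f j (u n) = 1 + f i₀ (n.1 i₀) := fun n => by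
    rw [← Finset.sum_erase_add _ _ (Finset.mem_univ i₀), huf1, huf0]
  have huη : ∀ n, |η (u n)| ≤ 1 + f i₀ (n.1 i₀) := fun n => by
    have hm : 0 < ∑ j, f j (u n) := by
      rw [hufs]; linarith [h.nonneg i₀ (n.2.1.mem i₀)]
    have := hwidth n _ (hauC n) _ hm fun i => by
      rw [haf, mul_comm]
      exact mul_le_mul_of_nonneg_right
        (Finset.single_le_sum (fun j _ => hufnn n j) (Finset.mem_univ i)) (ht n i).le
    rw [haη, abs_mul, abs_of_pos (hW n), hufs] at this
    exact le_of_mul_le_mul_left this (hW n)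
  have hfi₀ : Tendsto (fun n : α => f i₀ (n.1 i₀)) F (nhds 1) := by
    have : Tendsto (fun n : α => f i₀ (n.1 i₀)) F (nhds (f i₀ (v i₀))) :=
      ((f i₀).continuous.tendsto _).comp (hvi i₀)
    rwa [h.dual, if_pos rfl] at this
  have hubd : ∀ᶠ n in F, u n ∈ closedBall (0 : V) (3 * ‖p‖ + ∑ i, 3 * ‖v i‖) := by
    filter_upwards [hfi₀.eventually (gt_mem_nhds one_lt_two)] with n hn
    rw [mem_closedBall_zero_iff, h.expand (u n)]
    refine (norm_add_le _ _).trans (add_le_add ?_ ((norm_sum_le _ _).trans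
      (Finset.sum_le_sum fun i _ => ?_)))
    · rw [norm_smul, Real.norm_eq_abs]
      gcongr
      linarith [huη n]
    · rw [norm_smul, Real.norm_of_nonneg (hufnn n i)]
      gcongr
      have := Finset.single_le_sum (fun j _ => hufnn n j) (Finset.mem_univ i)
      rw [hufs] at this
      linarith
  obtain ⟨w, -, hw⟩ := (isCompact_closedBall (0 : V) _).ultrafilter_le_nhds' (F.map u) hubd
  have huw : Tendsto u F (nhds w) := hw
  have hfw : ∀ j, Tendsto (fun n => f j (u n)) F (nhds (f j w)) := fun j =>
    ((f j).continuous.tendsto _).comp huw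
  have hwi₀ : f i₀ w = 1 := by
    have := hfw i₀
    simp_rw [huf0] at this
    exact tendsto_nhds_unique this hfi₀
  have hws : ∑ j ∈ Finset.univ.erase i₀, f j w = 1 := by
    have : Tendsto (fun n => ∑ j ∈ Finset.univ.erase i₀, f j (u n)) F
        (nhds (∑ j ∈ Finset.univ.erase i₀, f j w)) := tendsto_finsetSum _ fun j _ => hfw j
    simp_rw [huf1] at this
    exact (tendsto_nhds_unique this tendsto_const_nhds)
  have hwC' : w ∈ closure C' := hcl u w huw (Eventually.of_forall hauC)
  obtain ⟨j₁, hj₁, hwj₁⟩ : ∃ j ∈ Finset.univ.erase i₀, 0 < f j w :=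
    Finset.exists_lt_of_sum_lt (f := fun _ => (0 : ℝ)) (by simp [hws])
  have hj₁' : j₁ ≠ i₀ := Finset.ne_of_mem_erase hj₁
  let b : ι → ℝ := fun i => if i = i₀ ∨ i = j₁ then 0 else 1
  have hb : ∀ i, 0 ≤ b i := fun i => by simp only [b]; split_ifs <;> norm_num
  have hsumC' : ∑ i, b i • v i ∈ closure C' :=
    hC'.sum_mem_closure _ (fun i _ => hb i) fun i _ => h'.mem i
  have hnotin : w + ∑ i, b i • v i ∉ C' := by
    intro hmem
    have hT : Tendsto (fun n => u n + ∑ i, b i • (a n).symm (n.1 i)) F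
        (nhds (w + ∑ i, b i • v i)) := by
      refine huw.add (tendsto_finsetSum _ fun i _ => ?_)
      by_cases hi : i = i₀
      · simp [b, hi]
      · exact (hu i hi).const_smul _
    obtain ⟨n, hn⟩ := (hlim _ _ hT hmem).exists
    have e : a n (u n + ∑ i, b i • (a n).symm (n.1 i)) =
        ∑ i, (b i + if i = i₀ then (τ n)⁻¹ else 0) • n.1 i := by
      simp [hau, add_smul, Finset.sum_add_distrib, ite_smul, add_comm]
    rw [e] at hn
    refine n.2.1.facet j₁ _ (fun i => add_nonneg (hb i) ?_) ?_ hn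
    · split_ifs
      · exact (inv_pos.2 (hτ n)).le
      · exact le_rfl
    · simp [b, hj₁']
  obtain ⟨g, hg, hg0⟩ := hC'.exists_support (hC'.add_mem_closure hwC' hsumC') hnotin
  have hgcl : ∀ x ∈ closure C', 0 ≤ g x := fun x hx =>
    IsOpenCone.nonneg_of_mem_closure (fun x hx => (hg x hx).le) hx
  have hgv : ∀ i, 0 ≤ g (v i) := fun i => hgcl _ (h'.mem i)
  rw [map_add] at hg0
  have hgw : g w = 0 := by linarith [hgcl _ hwC', hgcl _ hsumC']
  have hgs : ∑ i, b i * g (v i) = 0 := by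
    have : g (∑ i, b i • v i) = 0 := by linarith [hgcl _ hwC', hgcl _ hsumC']
    simpa using this
  rw [Finset.sum_eq_zero_iff_of_nonneg fun i _ => mul_nonneg (hb i) (hgv i)] at hgs
  have hgv1 : ∀ i, i ≠ i₀ → i ≠ j₁ → g (v i) = 0 := fun i h1 h2 => by
    simpa [b, h1, h2] using hgs i (Finset.mem_univ i)
  have hgp : g p = 0 := by
    obtain ⟨k, -, hk⟩ := Finset.exists_mem_notMem_of_card_lt_card
      (s := {i₀, j₁}) (t := (Finset.univ : Finset ι))
      ((Finset.card_le_two).trans_lt (by rw [Finset.card_univ]; omega))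
    simp only [Finset.mem_insert, Finset.mem_singleton, not_or] at hk
    exact h'.apply_p_eq_zero hC' (fun x hx => (hg x hx).le) (hgv1 k hk.1 hk.2)
  have hgexp : ∀ x, g x = ∑ i, f i x * g (v i) := fun x => by
    conv_lhs => rw [h.expand x]
    simp [hgp]
  have hgw' : ∀ i, f i w * g (v i) = 0 := by
    rw [hgexp, Finset.sum_eq_zero_iff_of_nonneg fun i _ =>
      mul_nonneg (h'.nonneg i hwC') (hgv i)] at hgw
    exact fun i => hgw i (Finset.mem_univ i)
  have hgv0 : ∀ i, g (v i) = 0 := fun i => by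
    by_cases h1 : i = i₀
    · subst h1
      simpa [hwi₀] using hgw' i
    by_cases h2 : i = j₁
    · subst h2
      exact (mul_eq_zero.1 (hgw' i)).resolve_left hwj₁.ne'
    · exact hgv1 i h1 h2
  obtain ⟨y, hy⟩ := hC'.nonempty
  have := hg y hy
  rw [hgexp] at this
  simp [hgv0] at this

section coneOver

variable {d : ℕ} {Ω : Set (Euc d)}

theorem mk_one_mem_coneOver {x : Euc d} : ((x, 1) : Euc d × ℝ) ∈ coneOver Ω ↔ x ∈ Ω := by
  refine ⟨?_, fun hx => ⟨1, one_pos, x, hx, by simp⟩⟩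
  rintro ⟨t, -, y, hy, he⟩
  simp only [Prod.smul_mk, Prod.mk.injEq, smul_eq_mul, mul_one] at he
  obtain ⟨h1, h2⟩ := he
  rwa [h1, ← h2, one_smul]

theorem smul_mem_coneOver_iff {s : ℝ} (hs : 0 < s) {p : Euc d × ℝ} :
    s • p ∈ coneOver Ω ↔ p ∈ coneOver Ω := by
  constructor
  · rintro ⟨t, ht, x, hx, he⟩
    refine ⟨s⁻¹ * t, by positivity, x, hx, ?_⟩
    rw [mul_smul, ← he, inv_smul_smul₀ hs.ne']
  · rintro ⟨t, ht, x, hx, rfl⟩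
    exact ⟨s * t, by positivity, x, hx, by rw [mul_smul]⟩

theorem isOpenCone_coneOver (hne : Ω.Nonempty) (hop : IsOpen Ω) (hconv : Convex ℝ Ω) :
    IsOpenCone (coneOver Ω) where
  nonempty := hne.imp' (fun x => (x, 1)) fun _ => mk_one_mem_coneOver.2
  isOpen := by
    have e : coneOver Ω = {p | 0 < p.2} ∩ (fun p : Euc d × ℝ => p.2⁻¹ • p.1) ⁻¹' Ω := by
      ext p
      constructor
      · rintro ⟨t, ht, x, hx, rfl⟩
        refine ⟨by simpa using ht, ?_⟩
        simpa [smul_smul, ht.ne'] using hx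
      · rintro ⟨h1, h2⟩
        have h1' : 0 < p.2 := h1
        refine ⟨p.2, h1, _, h2, ?_⟩
        ext1 <;> simp [smul_smul, h1'.ne']
    rw [e]
    refine ContinuousOn.isOpen_inter_preimage (fun p hp => ?_)
      (isOpen_lt continuous_const continuous_snd) hop
    have hp' : p.2 ≠ 0 := (show 0 < p.2 from hp).ne'
    exact ((continuousAt_snd.inv₀ hp').smul continuousAt_fst).continuousWithinAt
  convex := by
    rintro _ ⟨s, hs, x, hx, rfl⟩ _ ⟨t, ht, y, hy, rfl⟩ a b ha hb hab
    have hm : 0 < a * s + b * t := by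
      rcases ha.eq_or_lt with rfl | ha'
      · rw [zero_add] at hab
        subst hab
        simpa using ht
      · have := mul_nonneg hb ht.le
        positivity
    refine ⟨a * s + b * t, hm, (a * s / (a * s + b * t)) • x + (b * t / (a * s + b * t)) • y,
      hconv hx hy (by positivity) (by positivity) (by field_simp), ?_⟩
    ext1
    · simp only [Prod.fst_add, Prod.smul_fst, smul_add, smul_smul]
      rw [mul_div_cancel₀ _ hm.ne', mul_div_cancel₀ _ hm.ne']
    · simp
  smul_mem t ht _ hx := (smul_mem_coneOver_iff ht).2 hx

theorem mk_one_mem_closure_coneOver {x : Euc d} (hx : x ∈ closure Ω) :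
    ((x, 1) : Euc d × ℝ) ∈ closure (coneOver Ω) :=
  map_mem_closure (f := fun x : Euc d => ((x, 1) : Euc d × ℝ)) (by fun_prop) hx
    fun _ => mk_one_mem_coneOver.2

theorem Divides.exists_isCompact {Γ : Subgroup ((Euc d × ℝ) ≃ₗ[ℝ] (Euc d × ℝ))}
    (hdiv : Divides Ω Γ) :
    ∃ K ⊆ coneOver Ω, IsCompact K ∧ ∀ x ∈ coneOver Ω, ∃ g : (Euc d × ℝ) ≃L[ℝ] (Euc d × ℝ),
      (∀ y, g y ∈ coneOver Ω ↔ y ∈ coneOver Ω) ∧ g x ∈ K := by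
  obtain ⟨hΓ, -, -, K, hKΩ, hK, hcov⟩ := hdiv
  refine ⟨(fun x => ((x, 1) : Euc d × ℝ)) '' K, ?_, hK.image (by fun_prop), ?_⟩
  · rintro _ ⟨x, hx, rfl⟩
    exact mk_one_mem_coneOver.2 (hKΩ hx)
  rintro _ ⟨t, ht, x, hx, rfl⟩
  rw [← hcov] at hx
  simp only [mem_iUnion] at hx
  obtain ⟨γ, hγ, k, hk, rfl⟩ := hx
  have hγC : ∀ y, γ y ∈ coneOver Ω ↔ y ∈ coneOver Ω := fun y => by
    conv_lhs => rw [← hΓ γ hγ]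
    exact γ.injective.mem_set_image
  obtain ⟨m, hm, y, -, he⟩ := (hγC (k, 1)).2 (mk_one_mem_coneOver.2 (hKΩ hk))
  have hc : 0 < m / t := by positivity
  refine ⟨(γ.symm.trans (LinearEquiv.smulOfNeZero ℝ _ (m / t) hc.ne')).toContinuousLinearEquiv,
    fun y => ?_, k, hk, ?_⟩
  · refine (smul_mem_coneOver_iff hc (p := γ.symm y)).trans ?_
    rw [← hγC, γ.apply_symm_apply]
  · have h1 : t • ((projAct γ k, 1) : Euc d × ℝ) = (t / m) • γ (k, 1) := by
      rw [projAct, he]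
      ext1 <;> simp [smul_smul, hm.ne']
    change ((k, 1) : Euc d × ℝ) = (m / t) • γ.symm (t • (projAct γ k, 1))
    rw [h1, map_smul, γ.symm_apply_apply, smul_smul, div_mul_div_cancel₀ ht.ne', div_self hm.ne',
      one_smul]

theorem IsIrreducibleDomain.exists_notMem (hC : IsOpenCone (coneOver Ω)) (hd : d ≠ 0)
    (hirr : IsIrreducibleDomain Ω) {φ : (Euc d × ℝ) →L[ℝ] ℝ} {o : Euc d × ℝ} (hφo : φ o = 1)
    (hφ : ∀ y ∈ coneOver Ω, 0 < φ y) :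
    ∃ y ∈ coneOver Ω, ∃ s : ℝ, 0 < φ (y + s • o) ∧ y + s • o ∉ coneOver Ω := by
  by_contra! hsplit
  have ho : o ≠ 0 := by
    rintro rfl
    simp at hφo
  have hcompl : IsCompl (Submodule.span ℝ {o}) (LinearMap.ker (φ : (Euc d × ℝ) →ₗ[ℝ] ℝ)) := by
    constructor
    · rw [Submodule.disjoint_def]
      intro x hx hx'
      obtain ⟨c, rfl⟩ := Submodule.mem_span_singleton.1 hx
      have : c = 0 := by simpa [hφo] using hx'
      rw [this, zero_smul]
    · rw [codisjoint_iff_le_sup]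
      intro x _
      exact Submodule.mem_sup.2 ⟨φ x • o, Submodule.mem_span_singleton.2 ⟨_, rfl⟩, x - φ x • o,
        by simp [hφo], by abel⟩
  have h1 : Submodule.span ℝ {o} ≠ ⊥ := by simpa using ho
  have h2 : Submodule.span ℝ {o} ≠ ⊤ := by
    intro h
    have h3 := finrank_span_singleton (K := ℝ) ho
    rw [h, finrank_top, Module.finrank_prod, finrank_euclideanSpace_fin,
      Module.finrank_self] at h3
    omega
  refine hirr ⟨Submodule.span ℝ {o}, LinearMap.ker (φ : (Euc d × ℝ) →ₗ[ℝ] ℝ),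
    {x | ∃ t : ℝ, 0 < t ∧ x = t • o}, {w | φ w = 0 ∧ ∃ s : ℝ, w + s • o ∈ coneOver Ω},
    h1, ?_, h2, ?_, hcompl, ?_, ?_, ?_, ?_, ?_, ?_, ?_⟩
  · intro h
    rw [h] at hcompl
    exact h2 (by rw [← hcompl.sup_eq_top, sup_bot_eq])
  · intro h
    rw [h] at hcompl
    exact h1 (by rw [← hcompl.inf_eq_bot, inf_top_eq])
  · rintro _ ⟨t, -, rfl⟩
    exact Submodule.mem_span_singleton.2 ⟨t, rfl⟩
  · rintro w ⟨hw, -⟩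
    exact hw
  · rintro _ ⟨s, hs, rfl⟩ _ ⟨t, ht, rfl⟩ a b ha hb hab
    exact ⟨a * s + b * t, convex_Ioi (0 : ℝ) hs ht ha hb hab, by module⟩
  · rintro w ⟨hw, s, hs⟩ z ⟨hz, t, ht⟩ a b ha hb hab
    refine ⟨by simp [hw, hz], a * s + b * t, ?_⟩
    convert hC.convex hs ht ha hb hab using 1
    module
  · rintro t ht _ ⟨s, hs, rfl⟩
    exact ⟨t * s, by positivity, by rw [mul_smul]⟩
  · rintro t ht w ⟨hw, s, hs⟩
    refine ⟨by simp [hw], t * s, ?_⟩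
    rw [mul_smul, ← smul_add]
    exact hC.smul_mem t ht _ hs
  · ext x
    constructor
    · intro hx
      exact ⟨φ x • o, ⟨_, hφ x hx, rfl⟩, x - φ x • o, ⟨by simp [hφo], φ x, by simpa using hx⟩,
        by abel⟩
    · rintro ⟨_, ⟨t, ht, rfl⟩, w, ⟨hw, s, hs⟩, rfl⟩
      have h3 := hsplit _ hs (t - s)
      have e : w + s • o + (t - s) • o = t • o + w := by module
      rw [e] at h3
      exact h3 (by simpa [hw, hφo] using ht)

theorem isDivisibleCone_coneOver (hne : Ω.Nonempty) (hbd : Bornology.IsBounded Ω) (hop : IsOpen Ω)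
    (hconv : Convex ℝ Ω) (hd : d ≠ 0) (hirr : IsIrreducibleDomain Ω)
    {Γ : Subgroup ((Euc d × ℝ) ≃ₗ[ℝ] (Euc d × ℝ))} (hdiv : Divides Ω Γ) :
    IsDivisibleCone (coneOver Ω) where
  toIsOpenCone := isOpenCone_coneOver hne hop hconv
  salient := by
    obtain ⟨R, hR⟩ := hbd.exists_norm_le
    refine ⟨max R 1 • ContinuousLinearMap.snd ℝ (Euc d) ℝ, ?_⟩
    rintro _ ⟨t, ht, x, hx, rfl⟩
    rw [norm_smul, Real.norm_of_nonneg ht.le]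
    have : ‖((x, 1) : Euc d × ℝ)‖ ≤ max R 1 := by
      rw [Prod.norm_mk, norm_one]
      exact max_le_max_right _ (hR x hx)
    simp only [smul_apply, ContinuousLinearMap.coe_snd', Prod.smul_snd, smul_eq_mul, mul_one]
    rw [mul_comm]
    gcongr
  cocompact := hdiv.exists_isCompact
  irreducible _ _ := hirr.exists_notMem (isOpenCone_coneOver hne hop hconv) hd

end coneOver

theorem exists_stdSimplex_of_mem_convexHull_range {ι E : Type*} [Fintype ι] [AddCommGroup E]
    [Module ℝ E] {v : ι → E} {x : E} (hx : x ∈ convexHull ℝ (range v)) :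
    ∃ l ∈ stdSimplex ℝ ι, ∑ i, l i • v i = x := by
  classical
  let T : (ι → ℝ) →ₗ[ℝ] E := Fintype.linearCombination ℝ v
  have hconv : Convex ℝ (T '' stdSimplex ℝ ι) := (convex_stdSimplex ℝ ι).linear_image T
  obtain ⟨l, hl, h⟩ := convexHull_min (s := range v) (t := T '' stdSimplex ℝ ι)
    (by
      rintro _ ⟨i, rfl⟩
      exact ⟨Pi.single i 1, single_mem_stdSimplex ℝ i, by
        simp [T, Fintype.linearCombination_apply_single]⟩) hconv hx
  exact ⟨l, hl, by rw [← h, Fintype.linearCombination_apply]⟩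

theorem sum_smul_mk_one {ι E : Type*} [Fintype ι] [AddCommGroup E] [Module ℝ E] (a : ι → ℝ)
    (v : ι → E) :
    ∑ i, a i • ((v i, 1) : E × ℝ) = (∑ i, a i • v i, ∑ i, a i) := by
  ext1 <;> simp [Prod.fst_sum, Prod.snd_sum]

section IsFlatWith

variable {d : ℕ} {Ω : Set (Euc d)}

theorem IsFlatWith.sum_notMem_coneOver {v : Fin d → Euc d} (h : IsFlatWith Ω v) (j : Fin d)
    {a : Fin d → ℝ} (ha : ∀ i, 0 ≤ a i) (haj : a j = 0) :
    ∑ i, a i • ((v i, 1) : Euc d × ℝ) ∉ coneOver Ω := by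
  obtain ⟨hind, -, -, hbdry⟩ := h
  intro hmem
  rw [sum_smul_mk_one] at hmem
  have hm : 0 < ∑ i, a i := by
    obtain ⟨t, ht, x, -, he⟩ := hmem
    have := congrArg Prod.snd he
    simp only [Prod.smul_snd, smul_eq_mul, mul_one] at this
    rwa [this]
  set m := ∑ i, a i with hm_def
  have hq : ∑ i, (m⁻¹ * a i) • v i ∈ Ω := by
    rw [← mk_one_mem_coneOver, ← smul_mem_coneOver_iff hm]
    convert hmem using 1
    simp [Finset.smul_sum, smul_smul, hm.ne']
  set q := ∑ i, (m⁻¹ * a i) • v i with hq_def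
  have hsum : ∑ i, m⁻¹ * a i = 1 := by
    rw [← Finset.mul_sum, ← hm_def, inv_mul_cancel₀ hm.ne']
  have hqh : q ∈ convexHull ℝ (range v) :=
    (convex_convexHull ℝ _).sum_mem (fun i _ => mul_nonneg (inv_nonneg.2 hm.le) (ha i)) hsum
      fun i _ => subset_convexHull ℝ _ (mem_range_self i)
  have hqi : q ∈ intrinsicInterior ℝ (convexHull ℝ (range v)) := by
    by_contra hni
    exact (hbdry ⟨hqh, hni⟩).2 hq
  obtain ⟨y, hy, hyq⟩ := mem_intrinsicInterior.1 hqi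
  have hvj : v j ∈ affineSpan ℝ (convexHull ℝ (range v)) :=
    subset_affineSpan ℝ _ (subset_convexHull ℝ _ (mem_range_self j))
  have hline : ∀ t : ℝ, AffineMap.lineMap q (v j) t ∈ affineSpan ℝ (convexHull ℝ (range v)) :=
    fun t => AffineMap.lineMap_mem t (subset_affineSpan ℝ _ hqh) hvj
  let L : ℝ → affineSpan ℝ (convexHull ℝ (range v)) := fun t => ⟨_, hline t⟩
  have hL : Continuous L := by
    refine Continuous.subtype_mk ?_ _
    exact AffineMap.lineMap_continuous
  have hL0 : L 0 = y := by
    ext1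
    simp [L, hyq]
  have hev : ∀ᶠ t in nhds (0 : ℝ), L t ∈ interior
      ((↑) ⁻¹' convexHull ℝ (range v) : Set (affineSpan ℝ (convexHull ℝ (range v)))) :=
    hL.continuousAt.eventually (isOpen_interior.mem_nhds (by rw [hL0]; exact hy))
  obtain ⟨t, ht, ht0⟩ :=
    ((hev.filter_mono (nhdsWithin_le_nhds (s := Iio 0))).and eventually_mem_nhdsWithin).exists
  have hLt := interior_subset ht
  have ht' : AffineMap.lineMap q (v j) t ∈ convexHull ℝ (range v) := hLt
  have ht0' : t < 0 := ht0
  obtain ⟨l, hl, he⟩ := exists_stdSimplex_of_mem_convexHull_range ht'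
  rw [AffineMap.lineMap_apply_module, hq_def] at he
  have key := (affineIndependent_iff.1 hind) Finset.univ
    (fun i => l i - (1 - t) * (m⁻¹ * a i) - if i = j then t else 0)
    (by simp [Finset.sum_sub_distrib, hl.2, ← Finset.mul_sum, ← hm_def, hm.ne'])
    (by
      simp only [sub_smul, Finset.sum_sub_distrib, he, mul_smul, ← Finset.smul_sum, ite_smul,
        zero_smul, Finset.sum_ite_eq', Finset.mem_univ, if_true]
      module) j (Finset.mem_univ j)
  simp only [haj, mul_zero, sub_zero, if_true] at key
  linarith [hl.1 j]

/-- Vertex tuples of simplices in the closure of `Ω` that meet `B` and whose facets avoid `Ω`. -/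
def flatTuples (Ω B : Set (Euc d)) : Set (Fin d → Euc d) :=
  {w | (∀ i, w i ∈ closure Ω) ∧ (∃ l ∈ stdSimplex ℝ (Fin d), ∑ i, l i • w i ∈ B) ∧
    ∀ (j : Fin d) (a : Fin d → ℝ), (∀ i, 0 ≤ a i) → a j = 0 →
      ∑ i, a i • ((w i, 1) : Euc d × ℝ) ∉ coneOver Ω}

theorem isCompact_flatTuples (hC : IsOpen (coneOver Ω)) (hbd : Bornology.IsBounded Ω)
    {B : Set (Euc d)} (hB : IsClosed B) : IsCompact (flatTuples Ω B) := by
  have hT : IsCompact (((Set.univ.pi fun _ : Fin d => closure Ω) ×ˢ stdSimplex ℝ (Fin d)) ∩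
      {p : (Fin d → Euc d) × (Fin d → ℝ) | ∑ i, p.2 i • p.1 i ∈ B}) :=
    ((isCompact_univ_pi fun _ => hbd.isCompact_closure).prod
      (isCompact_stdSimplex ℝ (Fin d))).inter_right (hB.preimage (by fun_prop))
  have e : flatTuples Ω B = Prod.fst '' (((Set.univ.pi fun _ : Fin d => closure Ω) ×ˢ
      stdSimplex ℝ (Fin d)) ∩ {p : (Fin d → Euc d) × (Fin d → ℝ) | ∑ i, p.2 i • p.1 i ∈ B}) ∩
      ⋂ (j : Fin d) (a : Fin d → ℝ) (_ : ∀ i, 0 ≤ a i) (_ : a j = 0),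
        {w : Fin d → Euc d | ∑ i, a i • ((w i, 1) : Euc d × ℝ) ∈ coneOver Ω}ᶜ := by
    ext w
    simp only [flatTuples, mem_inter_iff, mem_iInter, mem_image, mem_compl_iff]
    constructor
    · rintro ⟨h1, ⟨l, hl, hlB⟩, h3⟩
      exact ⟨⟨(w, l), ⟨⟨fun i _ => h1 i, hl⟩, hlB⟩, rfl⟩, h3⟩
    · rintro ⟨⟨⟨_, l⟩, ⟨⟨h1, hl⟩, hlB⟩, rfl⟩, h3⟩
      exact ⟨fun i => h1 i trivial, ⟨l, hl, hlB⟩, h3⟩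
  rw [e]
  refine (hT.image continuous_fst).inter_right ?_
  refine isClosed_iInter fun j => isClosed_iInter fun a => isClosed_iInter fun _ =>
    isClosed_iInter fun _ => (hC.preimage ?_).isClosed_compl
  fun_prop

theorem isConeFlat_of_mem_flatTuples (hC : IsOpenCone (coneOver Ω)) {B : Set (Euc d)}
    (hB : B ⊆ Ω) {w : Fin d → Euc d} (hw : w ∈ flatTuples Ω B) :
    IsConeFlat (coneOver Ω) fun i => ((w i, 1) : Euc d × ℝ) := by
  obtain ⟨h1, ⟨l, hl, hlB⟩, h3⟩ := hw
  have hmem := fun i => mk_one_mem_closure_coneOver (h1 i)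
  refine ⟨hmem, ?_, h3⟩
  have hq : ∑ i, l i • ((w i, 1) : Euc d × ℝ) ∈ coneOver Ω := by
    rw [sum_smul_mk_one, hl.2]
    exact mk_one_mem_coneOver.2 (hB hlB)
  have hl1 : ∀ i, l i ≤ 1 := fun i => by
    rw [← hl.2]
    exact Finset.single_le_sum (fun j _ => hl.1 j) (Finset.mem_univ i)
  have := hC.add_closure_mem hq (hC.sum_mem_closure Finset.univ
    (fun i _ => sub_nonneg.2 (hl1 i)) fun i _ => hmem i)
  rw [← Finset.sum_add_distrib] at this
  convert this using 2 with i
  module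

theorem finite_flatTuples (hC : IsDivisibleCone (coneOver Ω)) (hbd : Bornology.IsBounded Ω)
    (hd : 3 ≤ d) {B : Set (Euc d)} (hB : IsClosed B) (hBΩ : B ⊆ Ω) : (flatTuples Ω B).Finite := by
  by_contra hinf
  obtain ⟨w, hw, hacc⟩ := Set.Infinite.exists_accPt_of_subset_isCompact hinf
    (isCompact_flatTuples hC.isOpen hbd hB) Subset.rfl
  rw [accPt_iff_frequently] at hacc
  refine hacc ?_
  have hcont : Continuous fun (w : Fin d → Euc d) (i : Fin d) => ((w i, 1) : Euc d × ℝ) := by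
    fun_prop
  have hev := eventually_all.2 fun i => (hcont.tendsto w).eventually
    ((isConeFlat_of_mem_flatTuples hC.toIsOpenCone hBΩ hw).eventually_eq_smul hC
      (by simp) (by simpa using hd) i)
  filter_upwards [hev] with z hz ⟨hne, hzS⟩
  refine hne (funext fun i => ?_)
  obtain ⟨c, hc⟩ := hz i (isConeFlat_of_mem_flatTuples hC.toIsOpenCone hBΩ hzS)
  simp only [Prod.smul_mk, Prod.mk.injEq, smul_eq_mul, mul_one] at hc
  rw [hc.1, ← hc.2, one_smul]

end IsFlatWith

theorem not_completely_foliated {d : ℕ} (Ω : Set (Euc d)) (hne : Ω.Nonempty)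
    (hbd : Bornology.IsBounded Ω) (hop : IsOpen Ω) (hconv : Convex ℝ Ω)
    (hd : 3 ≤ d) (hirr : IsIrreducibleDomain Ω)
    (Γ : Subgroup ((Euc d × ℝ) ≃ₗ[ℝ] (Euc d × ℝ)))
    (htf : TorsionFreeSub Γ) (hdiv : Divides Ω Γ)
    :
    ∃ x ∈ Ω, ∀ F : Set (Euc d), IsFlat Ω F → x ∉ F := by
  by_contra! hcov
  have hC := isDivisibleCone_coneOver hne hbd hop hconv (by omega) hirr hdiv
  obtain ⟨x₀, hx₀⟩ := hne
  obtain ⟨r, hr, hball⟩ := Metric.nhds_basis_closedBall.mem_iff.1 (hop.mem_nhds hx₀)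
  have hfin := finite_flatTuples hC hbd hd isClosed_closedBall hball
  have hsub : closedBall x₀ r ⊆ ⋃ w ∈ flatTuples Ω (closedBall x₀ r),
      (affineSpan ℝ (range w) : Set (Euc d)) := by
    intro x hx
    obtain ⟨F, ⟨v, hv, rfl⟩, hxF⟩ := hcov x (hball hx)
    have hxh := intrinsicInterior_subset hxF
    obtain ⟨l, hl, rfl⟩ := exists_stdSimplex_of_mem_convexHull_range hxh
    refine mem_iUnion₂.2 ⟨v, ⟨fun i => (hv.2.1 i).1, ⟨l, hl, hx⟩, fun j a => ?_⟩,
      convexHull_subset_affineSpan _ hxh⟩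
    exact hv.sum_notMem_coneOver j
  have hnull : MeasureTheory.volume (⋃ w ∈ flatTuples Ω (closedBall x₀ r),
      (affineSpan ℝ (range w) : Set (Euc d))) = 0 := by
    rw [MeasureTheory.measure_biUnion_null_iff hfin.countable]
    intro w _
    refine MeasureTheory.Measure.addHaar_affineSubspace _ _ fun htop => ?_
    have h1 := finrank_vectorSpan_range_le ℝ w (n := d - 1) (by simp; omega)
    rw [← direction_affineSpan, htop, AffineSubspace.direction_top, finrank_top,
      finrank_euclideanSpace_fin] at h1
    omega
  exact (Metric.measure_closedBall_pos MeasureTheory.volume x₀ hr).ne'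
    (MeasureTheory.measure_mono_null hsub hnull)
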